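/- arXiv:1809.08967 — 9 statements merged into one kernel-verified Lean document; each statement's English description precedes it below -/
import Mathlib

section
/- Maximum principle: Let ψ=(ψ₁,ψ₂)ᵀ with ψ₁,ψ₂ ∈ C²([0,1]). If ψ(0) ≥ 0 and ψ(1) ≥ 0 (componentwise) and (Lψ)(x) ≤ 0 (componentwise) for all x ∈ (0,1), then ψ(x) ≥ 0 (componentwise) for all x ∈ [0,1]. -/
open Set

/-- The second derivative is nonnegative at a local minimum. -/
theorem IsLocalMin.deriv_deriv_nonneg {f : ℝ → ℝ} {c : ℝ} (h : IsLocalMin f c)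
    (hf : ContinuousAt f c) : 0 ≤ deriv (deriv f) c := by
  by_contra! hneg
  have hmax : IsLocalMax f c := isLocalMax_of_deriv_deriv_neg hneg h.deriv_eq_zero hf
  have hconst : f =ᶠ[nhds c] fun _ => f c := by
    filter_upwards [h, hmax] with x hx hx' using le_antisymm hx' hx
  have hzero : deriv (deriv f) c = 0 := by
    rw [hconst.deriv.deriv_eq]
    simp
  exact hneg.ne hzero

/-- A minimum over `[0, 1]` of one component, not exceeding the value of the other component there,
is nonnegative as soon as the differential inequality holds. -/
theorem nonneg_of_isMinOn_Icc {ε : ℝ} {a b d f g : ℝ → ℝ} {c : ℝ} (hε : 0 ≤ ε)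
    (hbd : ∀ x ∈ Icc (0:ℝ) 1, 0 < b x - d x) (hd : ∀ x ∈ Icc (0:ℝ) 1, 0 ≤ d x)
    (hf : Continuous f) (h0 : 0 ≤ f 0) (h1 : 0 ≤ f 1)
    (hL : ∀ x ∈ Ioo (0:ℝ) 1,
      ε * deriv (deriv f) x + a x * deriv f x - b x * f x + d x * g x ≤ 0)
    (hc : c ∈ Icc (0:ℝ) 1) (hmin : IsMinOn f (Icc 0 1) c) (hfg : f c ≤ g c) : 0 ≤ f c := by
  by_contra! hneg
  have hc0 : 0 < c := hc.1.lt_of_ne (by rintro rfl; exact hneg.not_ge h0)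
  have hc1 : c < 1 := hc.2.lt_of_ne (by rintro rfl; exact hneg.not_ge h1)
  have hloc : IsLocalMin f c := hmin.isLocalMin (Icc_mem_nhds hc0 hc1)
  have hineq := hL c ⟨hc0, hc1⟩
  rw [hloc.deriv_eq_zero] at hineq
  have h2 := mul_nonneg hε (hloc.deriv_deriv_nonneg hf.continuousAt)
  have h3 := mul_le_mul_of_nonneg_left hfg (hd c hc)
  have h4 := mul_neg_of_pos_of_neg (hbd c hc) hneg
  linarith

/-- Maximum principle for the coupled convection-diffusion operator L. -/
theorem maximum_principle
    (ε₁ ε₂ α β : ℝ) (a₁ a₂ b₁₁ b₁₂ b₂₁ b₂₂ : ℝ → ℝ)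
    (hε₁ : 0 < ε₁) (hε₁₂ : ε₁ < ε₂) (hα : 0 < α) (hβ : 0 < β)
    (ha₁ : ∀ x ∈ Icc (0:ℝ) 1, α ≤ a₁ x) (ha₂ : ∀ x ∈ Icc (0:ℝ) 1, α ≤ a₂ x)
    (hb₁ : ∀ x ∈ Icc (0:ℝ) 1, β ≤ b₁₁ x - b₁₂ x)
    (hb₂ : ∀ x ∈ Icc (0:ℝ) 1, β ≤ b₂₂ x - b₂₁ x)
    (hb₁₂ : ∀ x ∈ Icc (0:ℝ) 1, 0 < b₁₂ x) (hb₂₁ : ∀ x ∈ Icc (0:ℝ) 1, 0 < b₂₁ x)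
    (ψ₁ ψ₂ : ℝ → ℝ) (hψ₁ : ContDiff ℝ 2 ψ₁) (hψ₂ : ContDiff ℝ 2 ψ₂)
    (h0 : 0 ≤ ψ₁ 0 ∧ 0 ≤ ψ₂ 0) (h1 : 0 ≤ ψ₁ 1 ∧ 0 ≤ ψ₂ 1)
    (hL : ∀ x ∈ Ioo (0:ℝ) 1,
      ε₁ * deriv (deriv ψ₁) x + a₁ x * deriv ψ₁ x - b₁₁ x * ψ₁ x + b₁₂ x * ψ₂ x ≤ 0 ∧
      ε₂ * deriv (deriv ψ₂) x + a₂ x * deriv ψ₂ x - b₂₂ x * ψ₂ x + b₂₁ x * ψ₁ x ≤ 0) :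
    ∀ x ∈ Icc (0:ℝ) 1, 0 ≤ ψ₁ x ∧ 0 ≤ ψ₂ x := by
  obtain ⟨c₁, hc₁, hmin₁⟩ :=
    isCompact_Icc.exists_isMinOn (nonempty_Icc.2 zero_le_one) hψ₁.continuous.continuousOn
  obtain ⟨c₂, hc₂, hmin₂⟩ :=
    isCompact_Icc.exists_isMinOn (nonempty_Icc.2 zero_le_one) hψ₂.continuous.continuousOn
  have key₁ : ψ₁ c₁ ≤ ψ₂ c₁ → 0 ≤ ψ₁ c₁ :=
    nonneg_of_isMinOn_Icc hε₁.le (fun x hx => hβ.trans_le (hb₁ x hx)) (fun x hx => (hb₁₂ x hx).le)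
      hψ₁.continuous h0.1 h1.1 (fun x hx => (hL x hx).1) hc₁ hmin₁
  have key₂ : ψ₂ c₂ ≤ ψ₁ c₂ → 0 ≤ ψ₂ c₂ :=
    nonneg_of_isMinOn_Icc (hε₁.trans hε₁₂).le (fun x hx => hβ.trans_le (hb₂ x hx))
      (fun x hx => (hb₂₁ x hx).le) hψ₂.continuous h0.2 h1.2 (fun x hx => (hL x hx).2) hc₂ hmin₂
  have hmin : 0 ≤ ψ₁ c₁ ∧ 0 ≤ ψ₂ c₂ := by
    rcases le_total (ψ₁ c₁) (ψ₂ c₂) with h | h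
    · have h' := key₁ (h.trans (hmin₂ hc₁))
      exact ⟨h', h'.trans h⟩
    · have h' := key₂ (h.trans (hmin₁ hc₂))
      exact ⟨h'.trans h, h'⟩
  exact fun x hx => ⟨hmin.1.trans (hmin₁ hx), hmin.2.trans (hmin₂ hx)⟩
end

section
/- Derivative bounds for the exact solution: There exists a constant C, depending only on α, β and the sup norms of the coefficient functions and their first derivatives but independent of ε₁, ε₂, such that if u=(u₁,u₂)ᵀ solves Lu=f on (0,1) (with f₁,f₂ ∈ C¹([0,1]), u₁,u₂ ∈ C³([0,1])), then for all x ∈ [0,1]: (i) |uᵢ⁽ᵏ⁾(x)| ≤ C εᵢ⁻ᵏ(‖u‖ + εᵢ‖f‖) for k=1,2 and i=1,2; (ii) |u₁⁽³⁾(x)| ≤ C ε₁⁻³(‖u‖ + ε₁‖f‖) + ε₁⁻¹‖f₁'‖; (iii) |u₂⁽³⁾(x)| ≤ C ε₂⁻²ε₁⁻¹(‖u‖ + ε₂‖f‖) + ε₂⁻¹‖f₂'‖. -/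
open Set

/-- A `C¹` function and its derivative are bounded on the unit interval by a common constant. -/
lemma exists_bound_C1 {g : ℝ → ℝ} (hg : ContDiff ℝ 1 g) :
    ∃ M : ℝ, 0 ≤ M ∧ ∀ x ∈ Icc (0:ℝ) 1, |g x| ≤ M ∧ |deriv g x| ≤ M := by
  obtain ⟨A, hA⟩ := isCompact_Icc.exists_bound_of_continuousOn
    (hg.continuous.continuousOn (s := Icc (0:ℝ) 1))
  obtain ⟨B, hB⟩ := isCompact_Icc.exists_bound_of_continuousOn
    ((hg.continuous_deriv le_rfl).continuousOn (s := Icc (0:ℝ) 1))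
  refine ⟨max 0 (max A B), le_max_left _ _, fun x hx => ⟨?_, ?_⟩⟩
  · exact (hA x hx).trans ((le_max_left _ _).trans (le_max_right _ _))
  · exact (hB x hx).trans ((le_max_right _ _).trans (le_max_right _ _))

/-- Continuous functions agreeing on the open unit interval agree on the closed one. -/
lemma eqOn_Icc_of_eqOn_Ioo {p q : ℝ → ℝ} (hp : Continuous p) (hq : Continuous q)
    (h : EqOn p q (Ioo (0:ℝ) 1)) : EqOn p q (Icc (0:ℝ) 1) := by
  have := h.closure hp hq
  rwa [closure_Ioo zero_ne_one] at this

lemma le_sSup_image_Icc {g : ℝ → ℝ} (hg : Continuous g) {x : ℝ} (hx : x ∈ Icc (0:ℝ) 1) :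
    g x ≤ sSup (g '' Icc (0:ℝ) 1) :=
  le_csSup (isCompact_Icc.bddAbove_image hg.continuousOn) (mem_image_of_mem g hx)

/-- The differential equation obtained by differentiating a second order equation. -/
lemma eqOn_deriv_equation {ε : ℝ} {a b c u v f : ℝ → ℝ}
    (ha : ContDiff ℝ 1 a) (hb : ContDiff ℝ 1 b) (hc : ContDiff ℝ 1 c)
    (hu : ContDiff ℝ 3 u) (hv : ContDiff ℝ 1 v) (hf : ContDiff ℝ 1 f)
    (h : EqOn (fun x => ε * deriv (deriv u) x + a x * deriv u x - b x * u x + c x * v x) f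
      (Ioo (0:ℝ) 1)) :
    EqOn (fun x => ε * deriv (deriv (deriv u)) x +
        (deriv a x * deriv u x + a x * deriv (deriv u) x) -
        (deriv b x * u x + b x * deriv u x) + (deriv c x * v x + c x * deriv v x))
      (deriv f) (Icc (0:ℝ) 1) := by
  have hu1 : ContDiff ℝ 2 (deriv u) := by
    have := hu.iterate_deriv' 2 1
    simpa using this
  have hu2 : ContDiff ℝ 1 (deriv (deriv u)) := by
    have := hu.iterate_deriv' 1 2
    simpa using this
  have c3 := hu2.continuous_deriv le_rfl
  have ca := ha.continuous_deriv le_rfl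
  have cb := hb.continuous_deriv le_rfl
  have cc := hc.continuous_deriv le_rfl
  have cv := hv.continuous_deriv le_rfl
  have c0 := ha.continuous
  have c0b := hb.continuous
  have c0c := hc.continuous
  have c0v := hv.continuous
  have c0u := hu.continuous
  have c1u := hu1.continuous
  have c2u := hu2.continuous
  refine eqOn_Icc_of_eqOn_Ioo (by fun_prop) (hf.continuous_deriv le_rfl) fun x hx => ?_
  have key := (h.eventuallyEq_of_mem (isOpen_Ioo.mem_nhds hx)).deriv_eq
  have d : ∀ {g : ℝ → ℝ}, ContDiff ℝ 1 g → HasDerivAt g (deriv g x) x := fun hg =>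
    ((hg.differentiable one_ne_zero) x).hasDerivAt
  have H := ((((d hu2).const_mul ε).add ((d ha).mul (d (hu1.of_le (by norm_num))))).sub
    ((d hb).mul (d (hu.of_le (by norm_num))))).add ((d hc).mul (d hv))
  rw [← key]
  exact H.deriv.symm

/-- Bound for the first derivative of the solution of a singularly perturbed equation. -/
lemma first_deriv_bound {M ε N F : ℝ} {a b c u v f : ℝ → ℝ} (hM : 0 ≤ M)
    (ha : ContDiff ℝ 1 a) (hu : ContDiff ℝ 3 u)
    (haM : ∀ x ∈ Icc (0:ℝ) 1, |a x| ≤ M ∧ |deriv a x| ≤ M)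
    (hbM : ∀ x ∈ Icc (0:ℝ) 1, |b x| ≤ M) (hcM : ∀ x ∈ Icc (0:ℝ) 1, |c x| ≤ M)
    (hε : 0 < ε) (hε1 : ε ≤ 1)
    (huN : ∀ x ∈ Icc (0:ℝ) 1, |u x| ≤ N) (hvN : ∀ x ∈ Icc (0:ℝ) 1, |v x| ≤ N)
    (hfF : ∀ x ∈ Icc (0:ℝ) 1, |f x| ≤ F)
    (h : EqOn (fun x => ε * deriv (deriv u) x + a x * deriv u x - b x * u x + c x * v x) f
      (Icc (0:ℝ) 1)) {x : ℝ} (hx : x ∈ Icc (0:ℝ) 1) :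
    ε * |deriv u x| ≤ (2 + 5 * M) * (N + ε * F) := by
  have hN : 0 ≤ N := (abs_nonneg _).trans (huN x hx)
  have hF : 0 ≤ F := (abs_nonneg _).trans (hfF x hx)
  have hu1 : ContDiff ℝ 2 (deriv u) := by
    have := hu.iterate_deriv' 2 1
    simpa using this
  have du : Differentiable ℝ u := hu.differentiable (by norm_num)
  have du1 : Differentiable ℝ (deriv u) := hu1.differentiable (by norm_num)
  have da : Differentiable ℝ a := ha.differentiable one_ne_zero
  obtain ⟨p, hp0, hp1, hpx, hxp⟩ : ∃ p : ℝ, 0 ≤ p ∧ p + ε ≤ 1 ∧ p ≤ x ∧ x ≤ p + ε := by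
    rcases le_total ε x with hc | hc
    · exact ⟨x - ε, by linarith, by linarith [hx.2], by linarith, by linarith⟩
    · exact ⟨0, le_rfl, by linarith, hx.1, by linarith⟩
  obtain ⟨z, hz, hzu⟩ := exists_deriv_eq_slope u (show p < p + ε by linarith)
    du.continuous.continuousOn du.differentiableOn
  have hzI : z ∈ Icc (0:ℝ) 1 := ⟨by linarith [hz.1], by linarith [hz.2]⟩
  have hzu' : ε * |deriv u z| ≤ 2 * N := by
    have e : ε * deriv u z = u (p + ε) - u p := by
      rw [hzu, add_sub_cancel_left, mul_div_cancel₀ _ hε.ne']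
    rw [← abs_of_pos hε, ← abs_mul, e]
    have h1 := huN (p + ε) ⟨by linarith, hp1⟩
    have h2 := huN p ⟨hp0, by linarith⟩
    linarith [abs_sub (u (p + ε)) (u p)]
  have hg : ∀ t ∈ Icc (0:ℝ) 1, HasDerivWithinAt (fun y => ε * deriv u y + a y * u y)
      (f t + deriv a t * u t + b t * u t - c t * v t) (Icc (0:ℝ) 1) t := by
    intro t ht
    have H := (((du1 t).hasDerivAt).const_mul ε).add
      (((da t).hasDerivAt).mul ((du t).hasDerivAt))
    have e := h ht
    simp only at e
    refine (H.congr_deriv ?_).hasDerivWithinAt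
    linarith
  have mul_bd : ∀ {s r : ℝ}, |s| ≤ M → |r| ≤ N → |s * r| ≤ M * N := fun hs hr => by
    rw [abs_mul]; exact mul_le_mul hs hr (abs_nonneg _) hM
  have hbd : ∀ t ∈ Icc (0:ℝ) 1,
      ‖f t + deriv a t * u t + b t * u t - c t * v t‖ ≤ F + 3 * (M * N) := by
    intro t ht
    rw [Real.norm_eq_abs]
    have h1 := abs_le.1 (mul_bd (haM t ht).2 (huN t ht))
    have h2 := abs_le.1 (mul_bd (hbM t ht) (huN t ht))
    have h3 := abs_le.1 (mul_bd (hcM t ht) (hvN t ht))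
    have h4 := abs_le.1 (hfF t ht)
    exact abs_le.2 ⟨by linarith, by linarith⟩
  have mvt := (convex_Icc (0:ℝ) 1).norm_image_sub_le_of_norm_hasDerivWithin_le hg hbd hzI hx
  rw [Real.norm_eq_abs, Real.norm_eq_abs] at mvt
  have hxz : |x - z| ≤ ε := abs_le.2 ⟨by linarith [hz.2], by linarith [hz.1]⟩
  have mvt' := mvt.trans (mul_le_mul_of_nonneg_left hxz (by positivity))
  have h1 := abs_le.1 (mul_bd (haM x hx).1 (huN x hx))
  have h2 := abs_le.1 (mul_bd (haM z hzI).1 (huN z hzI))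
  have h3 : |ε * deriv u z| ≤ 2 * N := by rwa [abs_mul, abs_of_pos hε]
  have h3 := abs_le.1 h3
  have h4 := abs_le.1 mvt'
  have hMN : 0 ≤ M * N := by positivity
  have h5 : ε * (M * N) ≤ M * N := mul_le_of_le_one_left hMN hε1
  have h6 : 0 ≤ M * (ε * F) := by positivity
  have h7 : 0 ≤ ε * F := by positivity
  have : |ε * deriv u x| ≤ (2 + 5 * M) * (N + ε * F) :=
    abs_le.2 ⟨by nlinarith [h4.1], by nlinarith [h4.2]⟩
  rwa [abs_mul, abs_of_pos hε] at this

/-- Bound for the second derivative, given a bound for the first one. -/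
lemma second_deriv_bound {M ε N F K a b c u v f d₁ d₂ : ℝ} (hM : 0 ≤ M) (hε : 0 < ε)
    (hε1 : ε ≤ 1) (ha : |a| ≤ M) (hb : |b| ≤ M) (hc : |c| ≤ M)
    (hu : |u| ≤ N) (hv : |v| ≤ N) (hf : |f| ≤ F)
    (h : ε * d₂ + a * d₁ - b * u + c * v = f)
    (h₁ : ε * |d₁| ≤ K * (N + ε * F)) :
    ε ^ 2 * |d₂| ≤ (1 + 2 * M + M * K) * (N + ε * F) := by
  have hN : 0 ≤ N := (abs_nonneg _).trans hu
  have hF : 0 ≤ F := (abs_nonneg _).trans hf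
  have e : ε * |d₂| ≤ F + M * |d₁| + 2 * (M * N) := by
    have m1 : |a * d₁| ≤ M * |d₁| := by rw [abs_mul]; gcongr
    have m2 : |b * u| ≤ M * N := by rw [abs_mul]; gcongr
    have m3 : |c * v| ≤ M * N := by rw [abs_mul]; gcongr
    rw [← abs_of_pos hε, ← abs_mul]
    rw [abs_le] at *
    constructor <;> linarith
  have hMN : 0 ≤ M * N := by positivity
  have h5 : ε * (M * N) ≤ M * N := mul_le_of_le_one_left hMN hε1
  have h6 : 0 ≤ M * (ε * F) := by positivity
  have e1 := mul_le_mul_of_nonneg_left e hε.le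
  have e2 := mul_le_mul_of_nonneg_left h₁ hM
  nlinarith

/-- Bound for the third derivative, given bounds for the first two. -/
lemma third_deriv_bound {M ε N F F' K K' a b c a' b' c' u v v' f' d₁ d₂ d₃ : ℝ} (hM : 0 ≤ M)
    (hε : 0 < ε) (hε1 : ε ≤ 1) (hF : 0 ≤ F) (hK : 0 ≤ K) (ha : |a| ≤ M) (hb : |b| ≤ M)
    (hc : |c| ≤ M) (ha' : |a'| ≤ M) (hb' : |b'| ≤ M) (hc' : |c'| ≤ M)
    (hu : |u| ≤ N) (hv : |v| ≤ N) (hf : |f'| ≤ F')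
    (h : ε * d₃ + (a' * d₁ + a * d₂) - (b' * u + b * d₁) + (c' * v + c * v') = f')
    (h₁ : ε * |d₁| ≤ K * (N + ε * F)) (h₂ : ε ^ 2 * |d₂| ≤ K' * (N + ε * F)) :
    ε * |d₃| ≤ F' + (M * K' + 2 * M * K + 2 * M) * (N + ε * F) / ε ^ 2 + M * |v'| := by
  have hN : 0 ≤ N := (abs_nonneg _).trans hu
  have e : ε * |d₃| ≤ F' + (M * |d₂| + 2 * (M * |d₁|) + 2 * (M * N)) + M * |v'| := by
    have m1 : |a' * d₁| ≤ M * |d₁| := by rw [abs_mul]; gcongr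
    have m2 : |a * d₂| ≤ M * |d₂| := by rw [abs_mul]; gcongr
    have m3 : |b' * u| ≤ M * N := by rw [abs_mul]; gcongr
    have m4 : |b * d₁| ≤ M * |d₁| := by rw [abs_mul]; gcongr
    have m5 : |c' * v| ≤ M * N := by rw [abs_mul]; gcongr
    have m6 : |c * v'| ≤ M * |v'| := by rw [abs_mul]; gcongr
    rw [← abs_of_pos hε, ← abs_mul]
    rw [abs_le] at *
    constructor <;> linarith
  have hS : 0 ≤ N + ε * F := by positivity
  have h₁' : ε ^ 2 * |d₁| ≤ K * (N + ε * F) := by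
    have : ε * (ε * |d₁|) ≤ ε * |d₁| := mul_le_of_le_one_left (by positivity) hε1
    nlinarith
  have h₀ : ε ^ 2 * N ≤ N + ε * F := by
    have : ε ^ 2 * N ≤ N := mul_le_of_le_one_left hN (pow_le_one₀ hε.le hε1)
    have : 0 ≤ ε * F := by positivity
    linarith
  have : M * |d₂| + 2 * (M * |d₁|) + 2 * (M * N) ≤
      (M * K' + 2 * M * K + 2 * M) * (N + ε * F) / ε ^ 2 := by
    rw [le_div_iff₀ (by positivity)]
    have e1 := mul_le_mul_of_nonneg_left h₂ hM
    have e2 := mul_le_mul_of_nonneg_left h₁' hM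
    have e3 := mul_le_mul_of_nonneg_left h₀ hM
    nlinarith
  linarith

/-- Derivative bounds for the exact solution of the coupled system, uniform in the
perturbation parameters. -/
theorem derivative_bounds
    (α β : ℝ) (a₁ a₂ b₁₁ b₁₂ b₂₁ b₂₂ : ℝ → ℝ)
    (hα : 0 < α) (hβ : 0 < β)
    (ha₁s : ContDiff ℝ 1 a₁) (ha₂s : ContDiff ℝ 1 a₂)
    (hb₁₁s : ContDiff ℝ 1 b₁₁) (hb₁₂s : ContDiff ℝ 1 b₁₂)
    (hb₂₁s : ContDiff ℝ 1 b₂₁) (hb₂₂s : ContDiff ℝ 1 b₂₂)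
    (ha₁ : ∀ x ∈ Icc (0:ℝ) 1, α ≤ a₁ x) (ha₂ : ∀ x ∈ Icc (0:ℝ) 1, α ≤ a₂ x)
    (hb₁ : ∀ x ∈ Icc (0:ℝ) 1, β ≤ b₁₁ x - b₁₂ x)
    (hb₂ : ∀ x ∈ Icc (0:ℝ) 1, β ≤ b₂₂ x - b₂₁ x)
    (hb₁₂ : ∀ x ∈ Icc (0:ℝ) 1, 0 < b₁₂ x) (hb₂₁ : ∀ x ∈ Icc (0:ℝ) 1, 0 < b₂₁ x) :
    ∃ C : ℝ, 0 < C ∧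
      ∀ ε₁ ε₂ : ℝ, 0 < ε₁ → ε₁ < ε₂ → ε₂ ≤ 1 →
      ∀ u₁ u₂ f₁ f₂ : ℝ → ℝ,
        ContDiff ℝ 3 u₁ → ContDiff ℝ 3 u₂ → ContDiff ℝ 1 f₁ → ContDiff ℝ 1 f₂ →
        (∀ x ∈ Ioo (0:ℝ) 1,
          ε₁ * deriv (deriv u₁) x + a₁ x * deriv u₁ x - b₁₁ x * u₁ x + b₁₂ x * u₂ x = f₁ x ∧
          ε₂ * deriv (deriv u₂) x + a₂ x * deriv u₂ x - b₂₂ x * u₂ x + b₂₁ x * u₁ x = f₂ x) →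
        ∀ Nu Nf Nf₁ Nf₂ : ℝ,
          Nu = sSup ((fun t => max |u₁ t| |u₂ t|) '' Icc (0:ℝ) 1) →
          Nf = sSup ((fun t => max |f₁ t| |f₂ t|) '' Icc (0:ℝ) 1) →
          Nf₁ = sSup ((fun t => |deriv f₁ t|) '' Icc (0:ℝ) 1) →
          Nf₂ = sSup ((fun t => |deriv f₂ t|) '' Icc (0:ℝ) 1) →
        ∀ x ∈ Icc (0:ℝ) 1,
          (∀ k : ℕ, k = 1 ∨ k = 2 →
            |iteratedDeriv k u₁ x| ≤ C / ε₁ ^ k * (Nu + ε₁ * Nf) ∧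
            |iteratedDeriv k u₂ x| ≤ C / ε₂ ^ k * (Nu + ε₂ * Nf)) ∧
          |iteratedDeriv 3 u₁ x| ≤ C / ε₁ ^ 3 * (Nu + ε₁ * Nf) + Nf₁ / ε₁ ∧
          |iteratedDeriv 3 u₂ x| ≤ C / (ε₂ ^ 2 * ε₁) * (Nu + ε₂ * Nf) + Nf₂ / ε₂ := by
  obtain ⟨M₁, p₁, ba₁⟩ := exists_bound_C1 ha₁s
  obtain ⟨M₂, p₂, ba₂⟩ := exists_bound_C1 ha₂s
  obtain ⟨M₃, p₃, bb₁₁⟩ := exists_bound_C1 hb₁₁s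
  obtain ⟨M₄, p₄, bb₁₂⟩ := exists_bound_C1 hb₁₂s
  obtain ⟨M₅, p₅, bb₂₁⟩ := exists_bound_C1 hb₂₁s
  obtain ⟨M₆, p₆, bb₂₂⟩ := exists_bound_C1 hb₂₂s
  obtain ⟨M, hM⟩ : ∃ M, M = M₁ + M₂ + M₃ + M₄ + M₅ + M₆ := ⟨_, rfl⟩
  have hM0 : 0 ≤ M := by rw [hM]; positivity
  have weaken : ∀ {g : ℝ → ℝ} {m : ℝ}, m ≤ M →
      (∀ x ∈ Icc (0:ℝ) 1, |g x| ≤ m ∧ |deriv g x| ≤ m) →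
      ∀ x ∈ Icc (0:ℝ) 1, |g x| ≤ M ∧ |deriv g x| ≤ M :=
    fun hm hg x hx => ⟨(hg x hx).1.trans hm, (hg x hx).2.trans hm⟩
  replace ba₁ := weaken (by linarith) ba₁
  replace ba₂ := weaken (by linarith) ba₂
  replace bb₁₁ := weaken (by linarith) bb₁₁
  replace bb₁₂ := weaken (by linarith) bb₁₂
  replace bb₂₁ := weaken (by linarith) bb₂₁
  replace bb₂₂ := weaken (by linarith) bb₂₂
  obtain ⟨K, hK⟩ : ∃ K, K = 2 + 5 * M := ⟨_, rfl⟩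
  obtain ⟨K', hK'⟩ : ∃ K', K' = 1 + 2 * M + M * K := ⟨_, rfl⟩
  obtain ⟨K'', hK''⟩ : ∃ K'', K'' = M * K' + 2 * M * K + 2 * M := ⟨_, rfl⟩
  have hK0 : 0 < K := by rw [hK]; positivity
  have hK'0 : 0 < K' := by rw [hK']; positivity
  have hK''0 : 0 ≤ K'' := by rw [hK'']; positivity
  have hMK : 0 ≤ M * K := by positivity
  refine ⟨K + K' + K'' + M * K, by positivity, ?_⟩
  intro ε₁ ε₂ hε₁ hε₁₂ hε₂1 u₁ u₂ f₁ f₂ hu₁ hu₂ hf₁ hf₂ heq Nu Nf Nf₁ Nf₂ hNu hNf hNf₁ hNf₂ x hx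
  have hε₂ : 0 < ε₂ := hε₁.trans hε₁₂
  have hε₁1 : ε₁ ≤ 1 := hε₁₂.le.trans hε₂1
  have cu₁ := hu₁.continuous
  have cu₂ := hu₂.continuous
  have cf₁ := hf₁.continuous
  have cf₂ := hf₂.continuous
  have uN : ∀ t ∈ Icc (0:ℝ) 1, max |u₁ t| |u₂ t| ≤ Nu := fun t ht => by
    rw [hNu]
    exact le_sSup_image_Icc (g := fun t => max |u₁ t| |u₂ t|) (by fun_prop) ht
  have fN : ∀ t ∈ Icc (0:ℝ) 1, max |f₁ t| |f₂ t| ≤ Nf := fun t ht => by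
    rw [hNf]
    exact le_sSup_image_Icc (g := fun t => max |f₁ t| |f₂ t|) (by fun_prop) ht
  have u₁N : ∀ t ∈ Icc (0:ℝ) 1, |u₁ t| ≤ Nu := fun t ht => (le_max_left _ _).trans (uN t ht)
  have u₂N : ∀ t ∈ Icc (0:ℝ) 1, |u₂ t| ≤ Nu := fun t ht => (le_max_right _ _).trans (uN t ht)
  have f₁N : ∀ t ∈ Icc (0:ℝ) 1, |f₁ t| ≤ Nf := fun t ht => (le_max_left _ _).trans (fN t ht)
  have f₂N : ∀ t ∈ Icc (0:ℝ) 1, |f₂ t| ≤ Nf := fun t ht => (le_max_right _ _).trans (fN t ht)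
  have df₁ : |deriv f₁ x| ≤ Nf₁ := by
    rw [hNf₁]
    exact le_sSup_image_Icc (hf₁.continuous_deriv le_rfl).abs hx
  have df₂ : |deriv f₂ x| ≤ Nf₂ := by
    rw [hNf₂]
    exact le_sSup_image_Icc (hf₂.continuous_deriv le_rfl).abs hx
  have hN : 0 ≤ Nu := (abs_nonneg _).trans (u₁N x hx)
  have hF : 0 ≤ Nf := (abs_nonneg _).trans (f₁N x hx)
  have cont2 : ∀ {u : ℝ → ℝ}, ContDiff ℝ 3 u →
      Continuous (deriv u) ∧ Continuous (deriv (deriv u)) := fun {u} hu => by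
    have h2 := (hu.iterate_deriv' 1 2).continuous
    exact ⟨hu.continuous_deriv (by norm_num), by simpa using h2⟩
  obtain ⟨cu₁1, cu₁2⟩ := cont2 hu₁
  obtain ⟨cu₂1, cu₂2⟩ := cont2 hu₂
  have ca₁ := ha₁s.continuous
  have ca₂ := ha₂s.continuous
  have cb₁₁ := hb₁₁s.continuous
  have cb₁₂ := hb₁₂s.continuous
  have cb₂₁ := hb₂₁s.continuous
  have cb₂₂ := hb₂₂s.continuous
  have E₁ := eqOn_Icc_of_eqOn_Ioo (by fun_prop) cf₁ fun t ht => (heq t ht).1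
  have E₂ := eqOn_Icc_of_eqOn_Ioo (by fun_prop) cf₂ fun t ht => (heq t ht).2
  have D₁ := eqOn_deriv_equation ha₁s hb₁₁s hb₁₂s hu₁ (hu₂.of_le (by norm_num)) hf₁
    fun t ht => (heq t ht).1
  have D₂ := eqOn_deriv_equation ha₂s hb₂₂s hb₂₁s hu₂ (hu₁.of_le (by norm_num)) hf₂
    fun t ht => (heq t ht).2
  have A₁ := first_deriv_bound hM0 ha₁s hu₁ ba₁ (fun t ht => (bb₁₁ t ht).1)
    (fun t ht => (bb₁₂ t ht).1) hε₁ hε₁1 u₁N u₂N f₁N E₁ hx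
  have A₂ := first_deriv_bound hM0 ha₂s hu₂ ba₂ (fun t ht => (bb₂₂ t ht).1)
    (fun t ht => (bb₂₁ t ht).1) hε₂ hε₂1 u₂N u₁N f₂N E₂ hx
  rw [← hK] at A₁ A₂
  have B₁ := second_deriv_bound hM0 hε₁ hε₁1 (ba₁ x hx).1 (bb₁₁ x hx).1 (bb₁₂ x hx).1
    (u₁N x hx) (u₂N x hx) (f₁N x hx) (E₁ hx) A₁
  have B₂ := second_deriv_bound hM0 hε₂ hε₂1 (ba₂ x hx).1 (bb₂₂ x hx).1 (bb₂₁ x hx).1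
    (u₂N x hx) (u₁N x hx) (f₂N x hx) (E₂ hx) A₂
  rw [← hK'] at B₁ B₂
  have G₁ := third_deriv_bound hM0 hε₁ hε₁1 hF hK0.le (ba₁ x hx).1 (bb₁₁ x hx).1 (bb₁₂ x hx).1
    (ba₁ x hx).2 (bb₁₁ x hx).2 (bb₁₂ x hx).2 (u₁N x hx) (u₂N x hx) df₁ (D₁ hx) A₁ B₁
  have G₂ := third_deriv_bound hM0 hε₂ hε₂1 hF hK0.le (ba₂ x hx).1 (bb₂₂ x hx).1 (bb₂₁ x hx).1
    (ba₂ x hx).2 (bb₂₂ x hx).2 (bb₂₁ x hx).2 (u₂N x hx) (u₁N x hx) df₂ (D₂ hx) A₂ B₂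
  rw [← hK''] at G₁ G₂
  have hS₁ : 0 ≤ Nu + ε₁ * Nf := by positivity
  have hS₂ : 0 ≤ Nu + ε₂ * Nf := by positivity
  have hS : Nu + ε₁ * Nf ≤ Nu + ε₂ * Nf := by gcongr
  have i2 : ∀ g : ℝ → ℝ, iteratedDeriv 2 g = deriv (deriv g) := fun g => by
    rw [iteratedDeriv_succ, iteratedDeriv_one]
  have i3 : ∀ g : ℝ → ℝ, iteratedDeriv 3 g = deriv (deriv (deriv g)) := fun g => by
    rw [iteratedDeriv_succ, i2]
  refine ⟨?_, ?_, ?_⟩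
  · rintro k (rfl | rfl)
    · simp only [iteratedDeriv_one, pow_one, div_mul_eq_mul_div]
      refine ⟨?_, ?_⟩
      · rw [le_div_iff₀ hε₁, mul_comm]
        exact A₁.trans (mul_le_mul_of_nonneg_right (by linarith) hS₁)
      · rw [le_div_iff₀ hε₂, mul_comm]
        exact A₂.trans (mul_le_mul_of_nonneg_right (by linarith) hS₂)
    · simp only [i2, div_mul_eq_mul_div]
      refine ⟨?_, ?_⟩
      · rw [le_div_iff₀ (by positivity), mul_comm]
        exact B₁.trans (mul_le_mul_of_nonneg_right (by linarith) hS₁)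
      · rw [le_div_iff₀ (by positivity), mul_comm]
        exact B₂.trans (mul_le_mul_of_nonneg_right (by linarith) hS₂)
  · rw [i3]
    have hv : |deriv u₂ x| ≤ K * (Nu + ε₁ * Nf) / ε₁ ^ 2 := by
      have h1 : ε₁ * |deriv u₂ x| ≤ K * (Nu + ε₁ * Nf) := by
        refine le_of_mul_le_mul_left (a := ε₂) ?_ hε₂
        have s1 := mul_le_mul_of_nonneg_left A₂ hε₁.le
        have s2 : ε₁ * (Nu + ε₂ * Nf) ≤ ε₂ * (Nu + ε₁ * Nf) := by nlinarith
        have s3 := mul_le_mul_of_nonneg_left s2 hK0.le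
        linarith
      rw [le_div_iff₀ (by positivity)]
      have h2 : ε₁ * (ε₁ * |deriv u₂ x|) ≤ ε₁ * |deriv u₂ x| :=
        mul_le_of_le_one_left (by positivity) hε₁1
      linarith
    have hMv := mul_le_mul_of_nonneg_left hv hM0
    have hC : (K'' + M * K) * ((Nu + ε₁ * Nf) / ε₁ ^ 2) ≤
        (K + K' + K'' + M * K) * ((Nu + ε₁ * Nf) / ε₁ ^ 2) :=
      mul_le_mul_of_nonneg_right (by linarith) (by positivity)
    have goal : ε₁ * |deriv (deriv (deriv u₁)) x| ≤
        Nf₁ + (K + K' + K'' + M * K) * ((Nu + ε₁ * Nf) / ε₁ ^ 2) := by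
      refine le_trans ?_ (add_le_add_right hC Nf₁)
      calc _ ≤ _ := G₁
        _ ≤ _ := add_le_add_right hMv _
        _ = _ := by ring
    rw [← le_div_iff₀' hε₁] at goal
    refine goal.trans_eq ?_
    field_simp
    ring
  · rw [i3]
    have hv : |deriv u₁ x| ≤ K * ((Nu + ε₂ * Nf) / (ε₂ * ε₁)) := by
      rw [← mul_div_assoc, le_div_iff₀ (by positivity)]
      have h2 : ε₂ * (ε₁ * |deriv u₁ x|) ≤ ε₁ * |deriv u₁ x| :=
        mul_le_of_le_one_left (by positivity) hε₂1
      have h3 := mul_le_mul_of_nonneg_left hS hK0.le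
      linarith
    have hMv := mul_le_mul_of_nonneg_left hv hM0
    have hq : (Nu + ε₂ * Nf) / ε₂ ^ 2 ≤ (Nu + ε₂ * Nf) / (ε₂ * ε₁) := by
      rw [pow_two]
      gcongr
    have hKq := mul_le_mul_of_nonneg_left hq hK''0
    have hC : (K'' + M * K) * ((Nu + ε₂ * Nf) / (ε₂ * ε₁)) ≤
        (K + K' + K'' + M * K) * ((Nu + ε₂ * Nf) / (ε₂ * ε₁)) :=
      mul_le_mul_of_nonneg_right (by linarith) (by positivity)
    have goal : ε₂ * |deriv (deriv (deriv u₂)) x| ≤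
        Nf₂ + (K + K' + K'' + M * K) * ((Nu + ε₂ * Nf) / (ε₂ * ε₁)) := by
      rw [mul_div_assoc] at G₂
      linarith
    rw [← le_div_iff₀' hε₂] at goal
    refine goal.trans_eq ?_
    field_simp
    ring
end

section
/- Estimates for the singular component: There exists a constant C, independent of ε₁ and ε₂, such that if w=(w₁,w₂)ᵀ (with w₁,w₂ ∈ C³([0,1])) solves Lw = 0 on (0,1) with w(1)=0 and max{|w₁(0)|,|w₂(0)|} ≤ C₀, then for all x ∈ [0,1]: |w₁(x)| ≤ C exp(−αx/ε₂), |w₂(x)| ≤ C exp(−αx/ε₂); |w₁⁽ᵏ⁾(x)| ≤ C(ε₁⁻ᵏ exp(−αx/ε₁) + ε₂⁻ᵏ exp(−αx/ε₂)) for k=1,2,3; |w₂⁽ᵏ⁾(x)| ≤ C ε₂⁻ᵏ exp(−αx/ε₂) for k=1,2; and |w₂⁽³⁾(x)| ≤ C ε₂⁻¹(ε₁⁻¹ exp(−αx/ε₁) + ε₂⁻² exp(−αx/ε₂)). The constant C may depend on C₀, α, β and the coefficient functions. -/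
open Set

theorem contDiff_deriv_of_succ {n : ℕ} {f : ℝ → ℝ} (hf : ContDiff ℝ (n + 1 : ℕ) f) :
    ContDiff ℝ n (deriv f) := by
  have h : ContDiff ℝ ((n : WithTop ℕ∞) + 1) f := by exact_mod_cast hf
  exact (contDiff_succ_iff_deriv.1 h).2.2

theorem deriv_deriv_nonneg_of_isLocalMin {z : ℝ → ℝ} {x : ℝ} (hz : Continuous z)
    (hmin : IsLocalMin z x) : 0 ≤ deriv (deriv z) x := by
  by_contra! hneg
  have hmax := isLocalMax_of_deriv_deriv_neg hneg hmin.deriv_eq_zero hz.continuousAt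
  have hconst : z =ᶠ[nhds x] fun _ => z x := by
    filter_upwards [hmin, hmax] with y h₁ h₂ using le_antisymm h₂ h₁
  have h : deriv (deriv z) x = 0 := by
    rw [hconst.deriv.deriv_eq]; simp
  linarith

theorem nonneg_of_first_order_ineq {ε : ℝ} {a u u' : ℝ → ℝ} (hε : 0 < ε) (ha : Continuous a)
    (hu : ContinuousOn u (Icc 0 1)) (hu' : ∀ x ∈ Ioo (0 : ℝ) 1, HasDerivAt u (u' x) x)
    (hineq : ∀ x ∈ Ioo (0 : ℝ) 1, 0 ≤ ε * u' x + a x * u x) (h0 : 0 ≤ u 0) :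
    ∀ x ∈ Icc (0 : ℝ) 1, 0 ≤ u x := by
  set A : ℝ → ℝ := fun x => ∫ t in (0 : ℝ)..x, a t
  have hA : ∀ x, HasDerivAt A (a x) x := fun x =>
    intervalIntegral.integral_hasDerivAt_right (ha.intervalIntegrable _ _)
      ha.aestronglyMeasurable.stronglyMeasurableAtFilter ha.continuousAt
  have hE : ∀ x, HasDerivAt (fun y => Real.exp (A y / ε)) (Real.exp (A x / ε) * (a x / ε)) x :=
    fun x => ((hA x).div_const ε).exp
  have hEc : Continuous fun y => Real.exp (A y / ε) :=
    continuous_iff_continuousAt.2 fun x => (hE x).continuousAt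
  have hmono : MonotoneOn (fun y => Real.exp (A y / ε) * u y) (Icc 0 1) := by
    refine monotoneOn_of_deriv_nonneg (convex_Icc 0 1) (hEc.continuousOn.mul hu) ?_ ?_
    · rw [interior_Icc]
      exact fun x hx => ((hE x).mul (hu' x hx)).differentiableAt.differentiableWithinAt
    · rw [interior_Icc]
      intro x hx
      rw [((hE x).fun_mul (hu' x hx)).deriv]
      have : Real.exp (A x / ε) * (a x / ε) * u x + Real.exp (A x / ε) * u' x
          = Real.exp (A x / ε) / ε * (ε * u' x + a x * u x) := by field_simp; ring
      rw [this]
      exact mul_nonneg (by positivity) (hineq x hx)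
  intro x hx
  have h := hmono (left_mem_Icc.2 zero_le_one) hx hx.1
  have h' : 0 ≤ Real.exp (A x / ε) * u x := le_trans (by positivity) h
  exact nonneg_of_mul_nonneg_right h' (Real.exp_pos _)

theorem nonneg_of_isMinOn_of_le {ε : ℝ} {a b c z₁ z₂ : ℝ → ℝ} {x : ℝ} (hε : 0 < ε)
    (hz : Continuous z₁) (hx : x ∈ Icc (0 : ℝ) 1) (hmin : IsMinOn z₁ (Icc 0 1) x)
    (hle : z₁ x ≤ z₂ x) (hbc : ∀ y ∈ Icc (0 : ℝ) 1, c y < b y)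
    (hc : ∀ y ∈ Icc (0 : ℝ) 1, 0 < c y)
    (hL : ∀ y ∈ Ioo (0 : ℝ) 1,
      ε * deriv (deriv z₁) y + a y * deriv z₁ y - b y * z₁ y + c y * z₂ y ≤ 0)
    (h0 : 0 ≤ z₁ 0) (h1 : 0 ≤ z₁ 1) : 0 ≤ z₁ x := by
  by_contra! hneg
  have hxI : x ∈ Ioo (0 : ℝ) 1 := by
    refine ⟨lt_of_le_of_ne hx.1 ?_, lt_of_le_of_ne hx.2 ?_⟩
    · rintro rfl; linarith
    · rintro rfl; linarith
  have hloc : IsLocalMin z₁ x := hmin.isLocalMin (Icc_mem_nhds hxI.1 hxI.2)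
  have h2 := mul_nonneg hε.le (deriv_deriv_nonneg_of_isLocalMin hz hloc)
  have hLx := hL x hxI
  rw [hloc.deriv_eq_zero] at hLx
  nlinarith [mul_le_mul_of_nonneg_left hle (hc x hx).le, hbc x hx]

theorem system_nonneg {ε₁ ε₂ : ℝ} {a₁ a₂ b₁₁ b₁₂ b₂₁ b₂₂ z₁ z₂ : ℝ → ℝ}
    (hε₁ : 0 < ε₁) (hε₂ : 0 < ε₂) (hz₁ : Continuous z₁) (hz₂ : Continuous z₂)
    (hb₁ : ∀ x ∈ Icc (0 : ℝ) 1, b₁₂ x < b₁₁ x) (hb₂ : ∀ x ∈ Icc (0 : ℝ) 1, b₂₁ x < b₂₂ x)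
    (hb₁₂ : ∀ x ∈ Icc (0 : ℝ) 1, 0 < b₁₂ x) (hb₂₁ : ∀ x ∈ Icc (0 : ℝ) 1, 0 < b₂₁ x)
    (hL₁ : ∀ x ∈ Ioo (0 : ℝ) 1,
      ε₁ * deriv (deriv z₁) x + a₁ x * deriv z₁ x - b₁₁ x * z₁ x + b₁₂ x * z₂ x ≤ 0)
    (hL₂ : ∀ x ∈ Ioo (0 : ℝ) 1,
      ε₂ * deriv (deriv z₂) x + a₂ x * deriv z₂ x - b₂₂ x * z₂ x + b₂₁ x * z₁ x ≤ 0)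
    (h₁0 : 0 ≤ z₁ 0) (h₁1 : 0 ≤ z₁ 1) (h₂0 : 0 ≤ z₂ 0) (h₂1 : 0 ≤ z₂ 1) :
    ∀ x ∈ Icc (0 : ℝ) 1, 0 ≤ z₁ x ∧ 0 ≤ z₂ x := by
  have hne : (Icc (0 : ℝ) 1).Nonempty := nonempty_Icc.2 zero_le_one
  obtain ⟨x₁, hx₁, hm₁⟩ := isCompact_Icc.exists_isMinOn hne hz₁.continuousOn
  obtain ⟨x₂, hx₂, hm₂⟩ := isCompact_Icc.exists_isMinOn hne hz₂.continuousOn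
  have key : 0 ≤ z₁ x₁ ∧ 0 ≤ z₂ x₂ := by
    rcases le_total (z₁ x₁) (z₂ x₂) with h | h
    · have := nonneg_of_isMinOn_of_le hε₁ hz₁ hx₁ hm₁ (h.trans (hm₂ hx₁)) hb₁ hb₁₂ hL₁ h₁0 h₁1
      exact ⟨this, this.trans h⟩
    · have := nonneg_of_isMinOn_of_le hε₂ hz₂ hx₂ hm₂ (h.trans (hm₁ hx₂)) hb₂ hb₂₁ hL₂ h₂0 h₂1
      exact ⟨this.trans h, this⟩
  exact fun x hx => ⟨key.1.trans (hm₁ hx), key.2.trans (hm₂ hx)⟩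

theorem eqOn_zero_and_deriv {g : ℝ → ℝ} (hg : ContDiff ℝ 1 g)
    (h : ∀ x ∈ Ioo (0 : ℝ) 1, g x = 0) :
    ∀ x ∈ Icc (0 : ℝ) 1, g x = 0 ∧ deriv g x = 0 := by
  have hd : ∀ x ∈ Ioo (0 : ℝ) 1, deriv g x = 0 := fun x hx => by
    have : g =ᶠ[nhds x] fun _ => 0 := by
      filter_upwards [isOpen_Ioo.mem_nhds hx] with y hy using h y hy
    rw [this.deriv_eq]; simp
  intro x hx
  rw [← closure_Ioo zero_ne_one] at hx
  exact ⟨Set.EqOn.closure (g := fun _ => 0) h hg.continuous continuous_const hx,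
    Set.EqOn.closure (g := fun _ => 0) hd (hg.continuous_deriv le_rfl) continuous_const hx⟩

/-- The boundary layer function `exp (-α x / ε)`. -/
noncomputable def layer (α ε x : ℝ) : ℝ := Real.exp (-(α * x) / ε)

/-- The sum of the two layer functions, weighted as for a derivative of order `k`. -/
noncomputable def layerSum (α ε₁ ε₂ : ℝ) (k : ℕ) (x : ℝ) : ℝ :=
  layer α ε₁ x / ε₁ ^ k + layer α ε₂ x / ε₂ ^ k

theorem layer_pos (α ε x : ℝ) : 0 < layer α ε x := Real.exp_pos _

theorem layer_zero (α ε : ℝ) : layer α ε 0 = 1 := by simp [layer]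

theorem hasDerivAt_layer (α ε x : ℝ) :
    HasDerivAt (layer α ε) (-(α / ε) * layer α ε x) x := by
  have h : HasDerivAt (fun y => -(α * y) / ε) (-(α * 1) / ε) x :=
    (((hasDerivAt_id x).const_mul α).fun_neg).div_const ε
  exact h.exp.congr_deriv (by rw [layer]; ring)

theorem continuous_layer (α ε : ℝ) : Continuous (layer α ε) :=
  continuous_iff_continuousAt.2 fun x => (hasDerivAt_layer α ε x).continuousAt

theorem barrier_nonpos {α ε ε₂ a b c K E : ℝ} (hα : 0 < α) (hle : ε ≤ ε₂) (hε₂ : 0 < ε₂)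
    (ha : α ≤ a) (hbc : c < b) (hK : 0 ≤ K) (hE : 0 ≤ E) :
    ε * (K * (-(α / ε₂) * (-(α / ε₂) * E))) + a * (K * (-(α / ε₂) * E)) - b * (K * E)
      + c * (K * E) ≤ 0 := by
  have hr : 0 < α / ε₂ := by positivity
  have h1 : ε * (α / ε₂) ≤ α := by
    rw [mul_div_assoc', div_le_iff₀ hε₂]; nlinarith
  have h2 : (α / ε₂) * (ε * (α / ε₂) - a) - (b - c) ≤ 0 := by nlinarith
  have h3 := mul_nonpos_of_nonneg_of_nonpos (mul_nonneg hK hE) h2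
  linarith [h3]

theorem layer_add_nonneg {α ε₁ ε₂ K : ℝ} {a₁ a₂ b₁₁ b₁₂ b₂₁ b₂₂ w₁ w₂ : ℝ → ℝ}
    (hα : 0 < α) (hε₁ : 0 < ε₁) (hle : ε₁ ≤ ε₂) (hK : 0 ≤ K)
    (ha₁ : ∀ x ∈ Icc (0 : ℝ) 1, α ≤ a₁ x) (ha₂ : ∀ x ∈ Icc (0 : ℝ) 1, α ≤ a₂ x)
    (hb₁ : ∀ x ∈ Icc (0 : ℝ) 1, b₁₂ x < b₁₁ x) (hb₂ : ∀ x ∈ Icc (0 : ℝ) 1, b₂₁ x < b₂₂ x)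
    (hb₁₂ : ∀ x ∈ Icc (0 : ℝ) 1, 0 < b₁₂ x) (hb₂₁ : ∀ x ∈ Icc (0 : ℝ) 1, 0 < b₂₁ x)
    (hw₁ : ContDiff ℝ 2 w₁) (hw₂ : ContDiff ℝ 2 w₂)
    (hL₁ : ∀ x ∈ Ioo (0 : ℝ) 1,
      ε₁ * deriv (deriv w₁) x + a₁ x * deriv w₁ x - b₁₁ x * w₁ x + b₁₂ x * w₂ x = 0)
    (hL₂ : ∀ x ∈ Ioo (0 : ℝ) 1,
      ε₂ * deriv (deriv w₂) x + a₂ x * deriv w₂ x - b₂₂ x * w₂ x + b₂₁ x * w₁ x = 0)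
    (h₁1 : w₁ 1 = 0) (h₂1 : w₂ 1 = 0) {s : ℝ} (h₁0 : 0 ≤ K + s * w₁ 0)
    (h₂0 : 0 ≤ K + s * w₂ 0) :
    ∀ x ∈ Icc (0 : ℝ) 1, 0 ≤ K * layer α ε₂ x + s * w₁ x ∧ 0 ≤ K * layer α ε₂ x + s * w₂ x := by
  have hε₂ : 0 < ε₂ := hε₁.trans_le hle
  have hd : ∀ {w : ℝ → ℝ}, ContDiff ℝ 2 w →
      deriv (fun x => K * layer α ε₂ x + s * w x)
        = fun x => K * (-(α / ε₂) * layer α ε₂ x) + s * deriv w x := fun {w} hw => by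
    funext x
    exact (((hasDerivAt_layer α ε₂ x).const_mul K).add
      (((hw.differentiable (by norm_num)) x).hasDerivAt.const_mul s)).deriv
  have hdd : ∀ {w : ℝ → ℝ}, ContDiff ℝ 2 w →
      deriv (deriv (fun x => K * layer α ε₂ x + s * w x))
        = fun x => K * (-(α / ε₂) * (-(α / ε₂) * layer α ε₂ x)) + s * deriv (deriv w) x :=
    fun {w} hw => by
      rw [hd hw]
      funext x
      have hw' : ContDiff ℝ (1 : ℕ) (deriv w) := contDiff_deriv_of_succ (by exact_mod_cast hw)
      exact ((((hasDerivAt_layer α ε₂ x).const_mul (-(α / ε₂))).const_mul K).add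
        (((hw'.differentiable (by norm_num)) x).hasDerivAt.const_mul s)).deriv
  refine system_nonneg (a₁ := a₁) (a₂ := a₂) hε₁ hε₂
    ((continuous_const.mul (continuous_layer _ _)).add (continuous_const.mul hw₁.continuous))
    ((continuous_const.mul (continuous_layer _ _)).add (continuous_const.mul hw₂.continuous))
    hb₁ hb₂ hb₁₂ hb₂₁ ?_ ?_ ?_ ?_ ?_ ?_
  · intro x hx
    rw [hdd hw₁, hd hw₁]
    have hxI := Ioo_subset_Icc_self hx
    have := barrier_nonpos hα hle hε₂ (ha₁ x hxI) (hb₁ x hxI) hK (layer_pos α ε₂ x).le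
    linear_combination this + s * hL₁ x hx
  · intro x hx
    rw [hdd hw₂, hd hw₂]
    have hxI := Ioo_subset_Icc_self hx
    have := barrier_nonpos hα le_rfl hε₂ (ha₂ x hxI) (hb₂ x hxI) hK (layer_pos α ε₂ x).le
    linear_combination this + s * hL₂ x hx
  · simpa [layer_zero] using h₁0
  · simpa [h₁1] using mul_nonneg hK (layer_pos α ε₂ 1).le
  · simpa [layer_zero] using h₂0
  · simpa [h₂1] using mul_nonneg hK (layer_pos α ε₂ 1).le

theorem abs_deriv_le_of_layer {α ε ε₂ K G M : ℝ} {a w : ℝ → ℝ} (hα : 0 ≤ α) (hε : 0 < ε)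
    (hle : ε ≤ ε₂) (hε₂ : ε₂ ≤ 1) (hK : 0 ≤ K) (hM : 0 ≤ M) (hG : 0 ≤ G)
    (ha : ContDiff ℝ 1 a) (hw : ContDiff ℝ 2 w)
    (hwK : ∀ x ∈ Icc (0 : ℝ) 1, |w x| ≤ K * layer α ε₂ x)
    (hode : ∀ x ∈ Icc (0 : ℝ) 1, |ε * deriv (deriv w) x + a x * deriv w x| ≤ G * layer α ε₂ x)
    (haM : ∀ x ∈ Icc (0 : ℝ) 1, |a x| ≤ M) (haM' : ∀ x ∈ Icc (0 : ℝ) 1, |deriv a x| ≤ M) :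
    ∀ x ∈ Icc (0 : ℝ) 1,
      |deriv w x| ≤ Real.exp (α / 2) * (4 * K + 3 * M * K + G) / ε * layer α ε₂ x := by
  intro x hx
  have hε₂0 : 0 < ε₂ := hε.trans_le hle
  obtain ⟨p, hp0, hpx, hxp, hp1⟩ : ∃ p, 0 ≤ p ∧ p ≤ x ∧ x ≤ p + ε / 2 ∧ p + ε / 2 ≤ 1 := by
    by_cases h : x + ε / 2 ≤ 1
    · exact ⟨x, hx.1, le_rfl, by linarith, h⟩
    · exact ⟨x - ε / 2, by linarith, by linarith, by linarith, by linarith [hx.2]⟩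
  have hsub : Icc p (p + ε / 2) ⊆ Icc 0 1 := Icc_subset_Icc hp0 hp1
  set E := Real.exp (α / 2) * layer α ε₂ x with hE
  have hEpos : 0 < E := mul_pos (Real.exp_pos _) (layer_pos _ _ _)
  have hlay : ∀ y ∈ Icc p (p + ε / 2), layer α ε₂ y ≤ E := by
    intro y hy
    rw [hE, layer, layer, ← Real.exp_add]
    apply Real.exp_le_exp.2
    rw [div_add_div _ _ two_ne_zero hε₂0.ne', div_le_div_iff₀ hε₂0 (by positivity)]
    have : α * (x - y) ≤ α * (ε₂ / 2) :=
      mul_le_mul_of_nonneg_left (by linarith [hy.1, hy.2]) hα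
    nlinarith
  have hw' : ContDiff ℝ (1 : ℕ) (deriv w) := contDiff_deriv_of_succ (by exact_mod_cast hw)
  have hwd : Differentiable ℝ w := hw.differentiable (by norm_num)
  have hwd' : Differentiable ℝ (deriv w) := hw'.differentiable (by norm_num)
  have had : Differentiable ℝ a := ha.differentiable (by norm_num)
  have hwE : ∀ y ∈ Icc p (p + ε / 2), |w y| ≤ K * E := fun y hy =>
    (hwK y (hsub hy)).trans (mul_le_mul_of_nonneg_left (hlay y hy) hK)
  have hawE : ∀ y ∈ Icc p (p + ε / 2), |a y * w y| ≤ M * (K * E) := fun y hy => by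
    rw [abs_mul]
    exact mul_le_mul (haM y (hsub hy)) (hwE y hy) (abs_nonneg _) hM
  have hφ : ∀ y, HasDerivAt (fun t => ε * deriv w t + a t * w t)
      (ε * deriv (deriv w) y + (deriv a y * w y + a y * deriv w y)) y := fun y =>
    ((hwd' y).hasDerivAt.const_mul ε).add ((had y).hasDerivAt.mul (hwd y).hasDerivAt)
  have hφE : ∀ y ∈ Icc p (p + ε / 2),
      ‖deriv (fun t => ε * deriv w t + a t * w t) y‖ ≤ (G + M * K) * E := by
    intro y hy
    rw [(hφ y).deriv, Real.norm_eq_abs]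
    have h1 := (hode y (hsub hy)).trans (mul_le_mul_of_nonneg_left (hlay y hy) hG)
    have h2 : |deriv a y * w y| ≤ M * (K * E) := by
      rw [abs_mul]
      exact mul_le_mul (haM' y (hsub hy)) (hwE y hy) (abs_nonneg _) hM
    rw [abs_le] at *
    constructor <;> linarith [h1.1, h1.2, h2.1, h2.2]
  have hh : p < p + ε / 2 := by linarith
  obtain ⟨z, hz, hzs⟩ := exists_deriv_eq_slope w hh hwd.continuous.continuousOn
    hwd.differentiableOn
  have hzI := Ioo_subset_Icc_self hz
  have hz' : |ε * deriv w z| ≤ 4 * K * E := by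
    have h1 := hwE p (left_mem_Icc.2 hh.le)
    have h2 := hwE _ (right_mem_Icc.2 hh.le)
    have h3 : ε * deriv w z = 2 * (w (p + ε / 2) - w p) := by
      rw [hzs, add_sub_cancel_left]; field_simp
    rw [h3]
    rw [abs_le] at *
    constructor <;> linarith [h1.1, h1.2, h2.1, h2.2]
  have hxI : x ∈ Icc p (p + ε / 2) := ⟨hpx, hxp⟩
  have hdiff := Convex.norm_image_sub_le_of_norm_deriv_le (fun y _ => (hφ y).differentiableAt)
    hφE (convex_Icc _ _) hzI hxI
  have hGE : 0 ≤ (G + M * K) * E := by positivity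
  have hxz : ‖x - z‖ ≤ 1 := by
    rw [Real.norm_eq_abs, abs_le]
    constructor <;> linarith [hz.1, hz.2]
  have hdiff' := hdiff.trans (mul_le_of_le_one_right hGE hxz)
  rw [Real.norm_eq_abs] at hdiff'
  have hax := hawE x hxI
  have haz := hawE z hzI
  have hfin : ε * |deriv w x| ≤ (4 * K + 3 * M * K + G) * E := by
    have habs : ε * |deriv w x| = |ε * deriv w x| := by rw [abs_mul, abs_of_pos hε]
    rw [habs]
    rw [abs_le] at *
    constructor <;> nlinarith [hax.1, hax.2, haz.1, haz.2, hz'.1, hz'.2, hdiff'.1, hdiff'.2]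
  calc |deriv w x| ≤ (4 * K + 3 * M * K + G) * E / ε := by
        rw [le_div_iff₀ hε]; linarith
    _ = _ := by rw [hE]; ring

theorem abs_le_of_first_order {α ε₁ ε₂ P Q V : ℝ} {a v v' : ℝ → ℝ} (hα : 0 < α) (hε₁ : 0 < ε₁)
    (hle : 2 * ε₁ ≤ ε₂) (hP : 0 ≤ P) (hQ : 0 ≤ Q) (ha : Continuous a)
    (haα : ∀ x ∈ Icc (0 : ℝ) 1, α ≤ a x) (hv : ContinuousOn v (Icc 0 1))
    (hv' : ∀ x ∈ Ioo (0 : ℝ) 1, HasDerivAt v (v' x) x)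
    (hode : ∀ x ∈ Ioo (0 : ℝ) 1,
      |ε₁ * v' x + a x * v x| ≤ P * layer α ε₁ x + Q * layer α ε₂ x) (h0 : |v 0| ≤ V) :
    ∀ x ∈ Icc (0 : ℝ) 1,
      |v x| ≤ (V + P / ε₁ * x) * layer α ε₁ x + 2 * Q / α * layer α ε₂ x := by
  have hV : 0 ≤ V := (abs_nonneg _).trans h0
  have hε₂ : 0 < ε₂ := by linarith
  have key : ∀ s : ℝ, |s| = 1 → ∀ x ∈ Icc (0 : ℝ) 1,
      0 ≤ (V + P / ε₁ * x) * layer α ε₁ x + 2 * Q / α * layer α ε₂ x + s * v x := by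
    intro s hs
    have hB : ∀ x, HasDerivAt
        (fun x => (V + P / ε₁ * x) * layer α ε₁ x + 2 * Q / α * layer α ε₂ x)
        (P / ε₁ * 1 * layer α ε₁ x + (V + P / ε₁ * x) * (-(α / ε₁) * layer α ε₁ x)
          + 2 * Q / α * (-(α / ε₂) * layer α ε₂ x)) x := fun x =>
      ((((hasDerivAt_id x).const_mul (P / ε₁)).const_add V).mul (hasDerivAt_layer α ε₁ x)).add
        ((hasDerivAt_layer α ε₂ x).const_mul _)
    refine nonneg_of_first_order_ineq hε₁ ha
      ((continuous_iff_continuousAt.2 fun x => (hB x).continuousAt).continuousOn.add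
        (continuousOn_const.mul hv))
      (fun x hx => (hB x).add ((hv' x hx).const_mul s)) ?_ ?_
    · intro x hx
      have hf : -(P * layer α ε₁ x + Q * layer α ε₂ x) ≤ s * (ε₁ * v' x + a x * v x) := by
        refine neg_le_of_abs_le ?_
        rw [abs_mul, hs, one_mul]
        exact hode x hx
      have he₁ := layer_pos α ε₁ x
      have he₂ := layer_pos α ε₂ x
      have hq : α * (ε₁ / ε₂) ≤ α / 2 := by
        rw [mul_div_assoc', div_le_div_iff₀ hε₂ two_pos]; nlinarith
      have hax := haα x (Ioo_subset_Icc_self hx)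
      have hVP : 0 ≤ V + P / ε₁ * x := by have := hx.1.le; positivity
      have h1 : 0 ≤ (a x - α) * ((V + P / ε₁ * x) * layer α ε₁ x) :=
        mul_nonneg (by linarith) (by positivity)
      have h2 : 0 ≤ (a x - α * (ε₁ / ε₂) - α / 2) * (2 * Q / α * layer α ε₂ x) :=
        mul_nonneg (by linarith) (by positivity)
      have h3 : ε₁ * (P / ε₁ * 1 * layer α ε₁ x + (V + P / ε₁ * x) * (-(α / ε₁) * layer α ε₁ x)
          + 2 * Q / α * (-(α / ε₂) * layer α ε₂ x) + s * v' x)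
          + a x * ((V + P / ε₁ * x) * layer α ε₁ x + 2 * Q / α * layer α ε₂ x + s * v x)
          = (a x - α) * ((V + P / ε₁ * x) * layer α ε₁ x)
            + (a x - α * (ε₁ / ε₂) - α / 2) * (2 * Q / α * layer α ε₂ x)
            + (s * (ε₁ * v' x + a x * v x) + (P * layer α ε₁ x + Q * layer α ε₂ x)) := by
        field_simp; ring
      rw [h3]
      linarith
    · have : -V ≤ s * v 0 := neg_le_of_abs_le (by rwa [abs_mul, hs, one_mul])
      have : 0 ≤ 2 * Q / α := by positivity
      simp only [layer_zero]
      linarith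
  intro x hx
  have h1 := key 1 (by simp) x hx
  have h2 := key (-1) (by simp) x hx
  exact abs_le.2 ⟨by linarith, by linarith⟩

theorem abs_le_layerSum_succ {α ε₁ ε₂ S V : ℝ} {k : ℕ} {a v v' : ℝ → ℝ} (hα : 0 < α)
    (hε₁ : 0 < ε₁) (hlt : ε₁ < ε₂) (hε₂ : ε₂ ≤ 1) (hS : 0 ≤ S) (hV : 0 ≤ V)
    (ha : Continuous a) (haα : ∀ x ∈ Icc (0 : ℝ) 1, α ≤ a x) (hv : ContinuousOn v (Icc 0 1))
    (hv' : ∀ x ∈ Ioo (0 : ℝ) 1, HasDerivAt v (v' x) x)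
    (hode : ∀ x ∈ Ioo (0 : ℝ) 1, |ε₁ * v' x + a x * v x| ≤ S * layerSum α ε₁ ε₂ k x)
    (hvV : ∀ x ∈ Icc (0 : ℝ) 1, |v x| ≤ V / ε₁ ^ (k + 1) * layer α ε₂ x) :
    ∀ x ∈ Icc (0 : ℝ) 1,
      |v x| ≤ (2 ^ (k + 1) * V + S + 2 * S / α) * layerSum α ε₁ ε₂ (k + 1) x := by
  intro x hx
  have hε₂0 : 0 < ε₂ := hε₁.trans hlt
  have he₁ := layer_pos α ε₁ x
  have he₂ := layer_pos α ε₂ x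
  have hSα : 0 ≤ 2 * S / α := by positivity
  rcases lt_or_ge ε₂ (2 * ε₁) with h | h
  · have hpow : 1 / ε₁ ^ (k + 1) ≤ 2 ^ (k + 1) / ε₂ ^ (k + 1) := by
      rw [div_le_div_iff₀ (by positivity) (by positivity), one_mul, ← mul_pow]
      gcongr
    calc |v x| ≤ V / ε₁ ^ (k + 1) * layer α ε₂ x := hvV x hx
      _ = V * layer α ε₂ x * (1 / ε₁ ^ (k + 1)) := by ring
      _ ≤ V * layer α ε₂ x * (2 ^ (k + 1) / ε₂ ^ (k + 1)) := by gcongr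
      _ = 2 ^ (k + 1) * V * (layer α ε₂ x / ε₂ ^ (k + 1)) := by ring
      _ ≤ (2 ^ (k + 1) * V + S + 2 * S / α) * layerSum α ε₁ ε₂ (k + 1) x := by
        have : 0 ≤ layer α ε₁ x / ε₁ ^ (k + 1) := by positivity
        rw [layerSum]
        gcongr
        · linarith
        · linarith
  · have h0 : |v 0| ≤ V / ε₁ ^ (k + 1) := by
      simpa [layer_zero] using hvV 0 (left_mem_Icc.2 zero_le_one)
    have hb := abs_le_of_first_order (P := S / ε₁ ^ k) (Q := S / ε₂ ^ k) hα hε₁ h (by positivity)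
      (by positivity) ha haα hv hv' (fun y hy => (hode y hy).trans_eq (by rw [layerSum]; ring))
      h0 x hx
    have hk : 1 / ε₂ ^ k ≤ 1 / ε₂ ^ (k + 1) :=
      one_div_le_one_div_of_le (by positivity) (pow_le_pow_of_le_one hε₂0.le hε₂ (by omega))
    have hV2 : V ≤ 2 ^ (k + 1) * V := le_mul_of_one_le_left hV (one_le_pow₀ one_le_two)
    calc |v x| ≤ _ := hb
      _ = (V + S * x) * (layer α ε₁ x / ε₁ ^ (k + 1))
          + 2 * S / α * layer α ε₂ x * (1 / ε₂ ^ k) := by rw [pow_succ]; field_simp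
      _ ≤ (2 ^ (k + 1) * V + S + 2 * S / α) * (layer α ε₁ x / ε₁ ^ (k + 1))
          + (2 * S / α) * layer α ε₂ x * (1 / ε₂ ^ (k + 1)) := by
        gcongr ?_ * _ + _ * ?_
        nlinarith [hx.2]
      _ = (2 ^ (k + 1) * V + S + 2 * S / α) * (layer α ε₁ x / ε₁ ^ (k + 1))
          + (2 * S / α) * (layer α ε₂ x / ε₂ ^ (k + 1)) := by ring
      _ ≤ (2 ^ (k + 1) * V + S + 2 * S / α) * (layer α ε₁ x / ε₁ ^ (k + 1))
          + (2 ^ (k + 1) * V + S + 2 * S / α) * (layer α ε₂ x / ε₂ ^ (k + 1)) := by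
        gcongr
        linarith
      _ = _ := by rw [layerSum]; ring

theorem layer_div_le_layerSum {α ε₁ ε₂ x : ℝ} {j k : ℕ} (hε₁ : 0 < ε₁) (hε₂ : 0 < ε₂)
    (h1 : ε₂ ≤ 1) (hjk : j ≤ k) : layer α ε₂ x / ε₂ ^ j ≤ layerSum α ε₁ ε₂ k x := by
  have he₁ := layer_pos α ε₁ x
  have he₂ := layer_pos α ε₂ x
  have : 0 ≤ layer α ε₁ x / ε₁ ^ k := by positivity
  have h : layer α ε₂ x / ε₂ ^ j ≤ layer α ε₂ x / ε₂ ^ k :=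
    div_le_div_of_nonneg_left he₂.le (by positivity) (pow_le_pow_of_le_one hε₂.le h1 hjk)
  rw [layerSum]
  linarith

theorem layerSum_le_succ {α ε₁ ε₂ x : ℝ} (k : ℕ) (hε₁ : 0 < ε₁) (hlt : ε₁ < ε₂)
    (h1 : ε₂ ≤ 1) : layerSum α ε₁ ε₂ k x ≤ layerSum α ε₁ ε₂ (k + 1) x :=
  add_le_add
    (div_le_div_of_nonneg_left (layer_pos _ _ _).le (by positivity)
      (pow_le_pow_of_le_one hε₁.le (hlt.le.trans h1) k.le_succ))
    (div_le_div_of_nonneg_left (layer_pos _ _ _).le (pow_pos (hε₁.trans hlt) _)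
      (pow_le_pow_of_le_one (hε₁.trans hlt).le h1 k.le_succ))

/-- The function and its first two derivatives are bounded by `M` on `[0, 1]`. -/
def C2BoundedBy (M : ℝ) (f : ℝ → ℝ) : Prop :=
  ∀ x ∈ Icc (0 : ℝ) 1, |f x| ≤ M ∧ |deriv f x| ≤ M ∧ |deriv (deriv f) x| ≤ M

theorem exists_forall_C2BoundedBy (l : List (ℝ → ℝ)) (hl : ∀ f ∈ l, ContDiff ℝ 2 f) :
    ∃ M : ℝ, 0 < M ∧ ∀ f ∈ l, C2BoundedBy M f := by
  induction l with
  | nil => exact ⟨1, one_pos, by simp⟩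
  | cons f l ih =>
    obtain ⟨M, hM, hMl⟩ := ih fun g hg => hl g (List.mem_cons_of_mem _ hg)
    have hf : ContDiff ℝ 2 f := hl f List.mem_cons_self
    have hf' : ContDiff ℝ (1 : ℕ) (deriv f) := contDiff_deriv_of_succ (by exact_mod_cast hf)
    obtain ⟨A, hA⟩ := isCompact_Icc.exists_bound_of_continuousOn (s := Icc (0 : ℝ) 1)
      hf.continuous.continuousOn
    obtain ⟨B, hB⟩ := isCompact_Icc.exists_bound_of_continuousOn (s := Icc (0 : ℝ) 1)
      hf'.continuous.continuousOn
    obtain ⟨D, hD⟩ := isCompact_Icc.exists_bound_of_continuousOn (s := Icc (0 : ℝ) 1)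
      (hf'.continuous_deriv (by norm_num)).continuousOn
    refine ⟨max M (max A (max B D)), lt_max_of_lt_left hM, ?_⟩
    intro g hg x hx
    rcases List.mem_cons.1 hg with rfl | hg
    · exact ⟨(hA x hx).trans (by simp), (hB x hx).trans (by simp), (hD x hx).trans (by simp)⟩
    · obtain ⟨h1, h2, h3⟩ := hMl g hg x hx
      exact ⟨h1.trans (le_max_left _ _), h2.trans (le_max_left _ _), h3.trans (le_max_left _ _)⟩

theorem deriv_mul_sub_mul {b c w u : ℝ → ℝ} (hb : Differentiable ℝ b) (hc : Differentiable ℝ c)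
    (hw : Differentiable ℝ w) (hu : Differentiable ℝ u) :
    deriv (fun x => b x * w x - c x * u x) = fun x =>
      (deriv b x * w x + b x * deriv w x) - (deriv c x * u x + c x * deriv u x) := by
  funext x
  exact (((hb x).hasDerivAt.mul (hw x).hasDerivAt).sub
    ((hc x).hasDerivAt.mul (hu x).hasDerivAt)).deriv

theorem deriv_deriv_mul_sub_mul {b c w u : ℝ → ℝ} (hb : ContDiff ℝ 2 b) (hc : ContDiff ℝ 2 c)
    (hw : ContDiff ℝ 2 w) (hu : ContDiff ℝ 2 u) :
    deriv (deriv (fun x => b x * w x - c x * u x)) = fun x =>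
      ((deriv (deriv b) x * w x + deriv b x * deriv w x)
        + (deriv b x * deriv w x + b x * deriv (deriv w) x))
      - ((deriv (deriv c) x * u x + deriv c x * deriv u x)
        + (deriv c x * deriv u x + c x * deriv (deriv u) x)) := by
  have hd : ∀ {f : ℝ → ℝ}, ContDiff ℝ 2 f → ∀ x, HasDerivAt f (deriv f x) x := fun hf x =>
    (hf.differentiable (by norm_num) x).hasDerivAt
  have hd' : ∀ {f : ℝ → ℝ}, ContDiff ℝ 2 f → ∀ x, HasDerivAt (deriv f) (deriv (deriv f) x) x :=
    fun {f} hf x => by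
      have h : ContDiff ℝ (1 : ℕ) (deriv f) := contDiff_deriv_of_succ (by exact_mod_cast hf)
      exact (h.differentiable (by norm_num) x).hasDerivAt
  rw [deriv_mul_sub_mul (hb.differentiable (by norm_num)) (hc.differentiable (by norm_num))
    (hw.differentiable (by norm_num)) (hu.differentiable (by norm_num))]
  funext x
  exact ((((hd' hb x).mul (hd hw x)).add ((hd hb x).mul (hd' hw x))).sub
    (((hd' hc x).mul (hd hu x)).add ((hd hc x).mul (hd' hu x)))).deriv

theorem abs_mul_le_mul_of_abs_le {p q M Q : ℝ} (hp : |p| ≤ M) (hq : |q| ≤ Q) :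
    |p * q| ≤ M * Q := by
  rw [abs_mul]
  exact mul_le_mul hp hq (abs_nonneg _) ((abs_nonneg _).trans hp)

theorem abs_mul_sub_mul_derivs_le {M : ℝ} {b c w u : ℝ → ℝ} (hbM : C2BoundedBy M b)
    (hcM : C2BoundedBy M c) (hb : ContDiff ℝ 2 b) (hc : ContDiff ℝ 2 c)
    (hw : ContDiff ℝ 2 w) (hu : ContDiff ℝ 2 u) :
    ∀ x ∈ Icc (0 : ℝ) 1,
      |b x * w x - c x * u x| ≤ M * (|w x| + |u x|) ∧
      |deriv (fun x => b x * w x - c x * u x) x|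
        ≤ M * (|w x| + |deriv w x| + |u x| + |deriv u x|) ∧
      |deriv (deriv (fun x => b x * w x - c x * u x)) x|
        ≤ M * (|w x| + 2 * |deriv w x| + |deriv (deriv w) x|
          + |u x| + 2 * |deriv u x| + |deriv (deriv u) x|) := by
  intro x hx
  obtain ⟨b0, b1, b2⟩ := hbM x hx
  obtain ⟨c0, c1, c2⟩ := hcM x hx
  rw [deriv_deriv_mul_sub_mul hb hc hw hu, deriv_mul_sub_mul (hb.differentiable (by norm_num))
    (hc.differentiable (by norm_num)) (hw.differentiable (by norm_num))
    (hu.differentiable (by norm_num))]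
  have B {p : ℝ} (hp : |p| ≤ M) (q : ℝ) := abs_le.1 (abs_mul_le_mul_of_abs_le hp (le_refl |q|))
  have p1 := B b0 (w x)
  have p2 := B b1 (w x)
  have p3 := B b2 (w x)
  have p4 := B b0 (deriv w x)
  have p5 := B b1 (deriv w x)
  have p6 := B b0 (deriv (deriv w) x)
  have q1 := B c0 (u x)
  have q2 := B c1 (u x)
  have q3 := B c2 (u x)
  have q4 := B c0 (deriv u x)
  have q5 := B c1 (deriv u x)
  have q6 := B c0 (deriv (deriv u) x)
  refine ⟨abs_le.2 ⟨?_, ?_⟩, abs_le.2 ⟨?_, ?_⟩, abs_le.2 ⟨?_, ?_⟩⟩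
  · linarith [p1.1, q1.2]
  · linarith [p1.2, q1.1]
  · linarith [p2.1, p4.1, q2.2, q4.2]
  · linarith [p2.2, p4.2, q2.1, q4.1]
  · linarith [p3.1, p5.1, p6.1, q3.2, q5.2, q6.2]
  · linarith [p3.2, p5.2, p6.2, q3.1, q5.1, q6.1]

theorem ode_and_deriv_on_Icc {ε : ℝ} {a w f : ℝ → ℝ} (ha : ContDiff ℝ 1 a)
    (hw : ContDiff ℝ 3 w) (hf : ContDiff ℝ 1 f)
    (h : ∀ x ∈ Ioo (0 : ℝ) 1, ε * deriv (deriv w) x + a x * deriv w x = f x) :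
    ∀ x ∈ Icc (0 : ℝ) 1, ε * deriv (deriv w) x + a x * deriv w x = f x ∧
      ε * deriv (deriv (deriv w)) x + a x * deriv (deriv w) x
        = deriv f x - deriv a x * deriv w x := by
  have hw' : ContDiff ℝ (2 : ℕ) (deriv w) := contDiff_deriv_of_succ (by exact_mod_cast hw)
  have hw'' : ContDiff ℝ (1 : ℕ) (deriv (deriv w)) := contDiff_deriv_of_succ hw'
  have hg : ContDiff ℝ 1 fun x => ε * deriv (deriv w) x + a x * deriv w x - f x :=
    ((contDiff_const.mul (by exact_mod_cast hw'')).add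
      (ha.mul (hw'.of_le (by norm_num)))).sub hf
  intro x hx
  obtain ⟨h0, h1⟩ := eqOn_zero_and_deriv hg (fun y hy => by rw [h y hy, sub_self]) x hx
  have hd : HasDerivAt (fun x => ε * deriv (deriv w) x + a x * deriv w x - f x)
      (ε * deriv (deriv (deriv w)) x + (deriv a x * deriv w x + a x * deriv (deriv w) x)
        - deriv f x) x :=
    (((hw''.differentiable (by norm_num) x).hasDerivAt.const_mul ε).add
      ((ha.differentiable (by norm_num) x).hasDerivAt.mul
        (hw'.differentiable (by norm_num) x).hasDerivAt)).sub
      (hf.differentiable (by norm_num) x).hasDerivAt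
  rw [hd.deriv] at h1
  exact ⟨by linarith, by linarith⟩

theorem abs_deriv_deriv_le_of_layer {α ε ε₂ G D M : ℝ} {a w : ℝ → ℝ} (hε : 0 < ε) (hε1 : ε ≤ 1)
    (hG : 0 ≤ G) (haM : ∀ x ∈ Icc (0 : ℝ) 1, |a x| ≤ M)
    (hode : ∀ x ∈ Icc (0 : ℝ) 1, |ε * deriv (deriv w) x + a x * deriv w x| ≤ G * layer α ε₂ x)
    (hw : ∀ x ∈ Icc (0 : ℝ) 1, |deriv w x| ≤ D / ε * layer α ε₂ x) :
    ∀ x ∈ Icc (0 : ℝ) 1, |deriv (deriv w) x| ≤ (G + M * D) / ε ^ 2 * layer α ε₂ x := by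
  intro x hx
  have he := layer_pos α ε₂ x
  have h1 := abs_le.1 (hode x hx)
  have h2 := abs_le.1 (abs_mul_le_mul_of_abs_le (haM x hx) (hw x hx))
  have h3 : ε * |deriv (deriv w) x| ≤ G * layer α ε₂ x + M * (D / ε * layer α ε₂ x) := by
    have habs : ε * |deriv (deriv w) x| = |ε * deriv (deriv w) x| := by
      rw [abs_mul, abs_of_pos hε]
    rw [habs, abs_le]
    constructor <;> linarith [h1.1, h1.2, h2.1, h2.2]
  have h4 : G * layer α ε₂ x ≤ G * layer α ε₂ x / ε := le_div_self (by positivity) hε hε1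
  calc |deriv (deriv w) x| ≤ (G * layer α ε₂ x / ε + M * (D / ε * layer α ε₂ x)) / ε := by
        rw [le_div_iff₀ hε]; linarith
    _ = _ := by field_simp

theorem abs_third_deriv_le_layerSum {α ε₁ ε₂ S V : ℝ} {a w f : ℝ → ℝ} (hα : 0 < α)
    (hε₁ : 0 < ε₁) (hlt : ε₁ < ε₂) (hε₂ : ε₂ ≤ 1) (hS : 0 ≤ S) (hV : 0 ≤ V)
    (ha : ContDiff ℝ 2 a) (hw : ContDiff ℝ 3 w) (hf : ContDiff ℝ 2 f)
    (haα : ∀ x ∈ Icc (0 : ℝ) 1, α ≤ a x)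
    (hode : ∀ x ∈ Icc (0 : ℝ) 1, ε₁ * deriv (deriv (deriv w)) x + a x * deriv (deriv w) x
        = deriv f x - deriv a x * deriv w x)
    (hfS : ∀ x ∈ Icc (0 : ℝ) 1, |deriv (deriv f) x - deriv (deriv a) x * deriv w x
        - 2 * (deriv a x * deriv (deriv w) x)| ≤ S * layerSum α ε₁ ε₂ 2 x)
    (hwV : ∀ x ∈ Icc (0 : ℝ) 1, |deriv (deriv (deriv w)) x| ≤ V / ε₁ ^ 3 * layer α ε₂ x) :
    ∀ x ∈ Icc (0 : ℝ) 1, |deriv (deriv (deriv w)) x|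
      ≤ (2 ^ 3 * V + S + 2 * S / α) * layerSum α ε₁ ε₂ 3 x := by
  have ha' : ContDiff ℝ (1 : ℕ) (deriv a) := contDiff_deriv_of_succ (by exact_mod_cast ha)
  have hf' : ContDiff ℝ (1 : ℕ) (deriv f) := contDiff_deriv_of_succ (by exact_mod_cast hf)
  have hw' : ContDiff ℝ (2 : ℕ) (deriv w) := contDiff_deriv_of_succ (by exact_mod_cast hw)
  have hw'' : ContDiff ℝ (1 : ℕ) (deriv (deriv w)) := contDiff_deriv_of_succ hw'
  set v : ℝ → ℝ := fun x =>
    (deriv f x - deriv a x * deriv w x - a x * deriv (deriv w) x) / ε₁ with hvdef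
  have hvw : ∀ x ∈ Icc (0 : ℝ) 1, v x = deriv (deriv (deriv w)) x := fun x hx => by
    rw [hvdef, div_eq_iff hε₁.ne']; linarith [hode x hx]
  have hv : ∀ x, HasDerivAt v
      ((deriv (deriv f) x - (deriv (deriv a) x * deriv w x + deriv a x * deriv (deriv w) x)
        - (deriv a x * deriv (deriv w) x + a x * deriv (deriv (deriv w)) x)) / ε₁) x := fun x =>
    (((hf'.differentiable (by norm_num) x).hasDerivAt.sub
      ((ha'.differentiable (by norm_num) x).hasDerivAt.mul
        (hw'.differentiable (by norm_num) x).hasDerivAt)).sub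
      ((ha.differentiable (by norm_num) x).hasDerivAt.mul
        (hw''.differentiable (by norm_num) x).hasDerivAt)).div_const ε₁
  intro x hx
  rw [← hvw x hx]
  refine abs_le_layerSum_succ (k := 2) (a := a) hα hε₁ hlt hε₂ hS hV ha.continuous haα
    (continuous_iff_continuousAt.2 fun y => (hv y).continuousAt).continuousOn
    (fun y _ => hv y) ?_ (fun y hy => by rw [hvw y hy]; exact hwV y hy) x hx
  intro y hy
  have hyI := Ioo_subset_Icc_self hy
  convert hfS y hyI using 2
  rw [hvw y hyI]
  field_simp
  ring

/-- Estimates for the singular component w and its derivatives in terms of the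
layer functions exp(-αx/ε₁) and exp(-αx/ε₂). -/
theorem singular_component_estimates
    (α β C₀ : ℝ) (a₁ a₂ b₁₁ b₁₂ b₂₁ b₂₂ : ℝ → ℝ)
    (hα : 0 < α) (hβ : 0 < β) (hC₀ : 0 ≤ C₀)
    (ha₁s : ContDiff ℝ 3 a₁) (ha₂s : ContDiff ℝ 3 a₂)
    (hb₁₁s : ContDiff ℝ 3 b₁₁) (hb₁₂s : ContDiff ℝ 3 b₁₂)
    (hb₂₁s : ContDiff ℝ 3 b₂₁) (hb₂₂s : ContDiff ℝ 3 b₂₂)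
    (ha₁ : ∀ x ∈ Icc (0:ℝ) 1, α ≤ a₁ x) (ha₂ : ∀ x ∈ Icc (0:ℝ) 1, α ≤ a₂ x)
    (hb₁ : ∀ x ∈ Icc (0:ℝ) 1, β ≤ b₁₁ x - b₁₂ x)
    (hb₂ : ∀ x ∈ Icc (0:ℝ) 1, β ≤ b₂₂ x - b₂₁ x)
    (hb₁₂ : ∀ x ∈ Icc (0:ℝ) 1, 0 < b₁₂ x) (hb₂₁ : ∀ x ∈ Icc (0:ℝ) 1, 0 < b₂₁ x) :
    ∃ C : ℝ, 0 < C ∧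
      ∀ ε₁ ε₂ : ℝ, 0 < ε₁ → ε₁ < ε₂ → ε₂ ≤ 1 →
      ∀ w₁ w₂ : ℝ → ℝ,
        ContDiff ℝ 3 w₁ → ContDiff ℝ 3 w₂ →
        (∀ x ∈ Ioo (0:ℝ) 1,
          ε₁ * deriv (deriv w₁) x + a₁ x * deriv w₁ x - b₁₁ x * w₁ x + b₁₂ x * w₂ x = 0 ∧
          ε₂ * deriv (deriv w₂) x + a₂ x * deriv w₂ x - b₂₂ x * w₂ x + b₂₁ x * w₁ x = 0) →
        w₁ 1 = 0 → w₂ 1 = 0 → max |w₁ 0| |w₂ 0| ≤ C₀ →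
        ∀ x ∈ Icc (0:ℝ) 1,
          |w₁ x| ≤ C * Real.exp (-(α * x) / ε₂) ∧
          |w₂ x| ≤ C * Real.exp (-(α * x) / ε₂) ∧
          (∀ k : ℕ, 1 ≤ k → k ≤ 3 →
            |iteratedDeriv k w₁ x| ≤
              C * (Real.exp (-(α * x) / ε₁) / ε₁ ^ k + Real.exp (-(α * x) / ε₂) / ε₂ ^ k)) ∧
          (∀ k : ℕ, 1 ≤ k → k ≤ 2 →
            |iteratedDeriv k w₂ x| ≤ C * (Real.exp (-(α * x) / ε₂) / ε₂ ^ k)) ∧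
          |iteratedDeriv 3 w₂ x| ≤
            C / ε₂ * (Real.exp (-(α * x) / ε₁) / ε₁ + Real.exp (-(α * x) / ε₂) / ε₂ ^ 2) := by
  obtain ⟨M, hM, hMl⟩ := exists_forall_C2BoundedBy [a₁, a₂, b₁₁, b₁₂, b₂₁, b₂₂] (by
    simp only [List.mem_cons, List.not_mem_nil, or_false]
    rintro f (rfl | rfl | rfl | rfl | rfl | rfl)
    all_goals exact ContDiff.of_le ‹_› (by norm_num))
  simp only [List.mem_cons, List.not_mem_nil, or_false, forall_eq_or_imp, forall_eq] at hMl
  obtain ⟨ha₁M, ha₂M, hb₁₁M, hb₁₂M, hb₂₁M, hb₂₂M⟩ := hMl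
  have hM0 := hM.le
  obtain ⟨G, hG⟩ : ∃ G, G = M * (C₀ + C₀) := ⟨_, rfl⟩
  have hG0 : 0 ≤ G := by rw [hG]; positivity
  obtain ⟨D₁, hD₁⟩ : ∃ D, D = Real.exp (α / 2) * (4 * C₀ + 3 * M * C₀ + G) := ⟨_, rfl⟩
  have hD₁0 : 0 ≤ D₁ := by rw [hD₁]; positivity
  obtain ⟨D₂, hD₂⟩ : ∃ D, D = G + M * D₁ := ⟨_, rfl⟩
  have hD₂0 : 0 ≤ D₂ := by rw [hD₂]; positivity
  obtain ⟨D₃, hD₃⟩ : ∃ D, D = M * (2 * C₀ + 3 * D₁ + D₂) := ⟨_, rfl⟩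
  have hD₃0 : 0 ≤ D₃ := by rw [hD₃]; positivity
  obtain ⟨R₁, hR₁⟩ : ∃ R, R = 2 ^ (0 + 1) * D₁ + G + 2 * G / α := ⟨_, rfl⟩
  have hR₁0 : 0 ≤ R₁ := by rw [hR₁]; positivity
  obtain ⟨S₂, hS₂⟩ : ∃ S, S = M * (2 * C₀ + 2 * R₁ + D₁) := ⟨_, rfl⟩
  have hS₂0 : 0 ≤ S₂ := by rw [hS₂]; positivity
  obtain ⟨R₂, hR₂⟩ : ∃ R, R = 2 ^ (1 + 1) * D₂ + S₂ + 2 * S₂ / α := ⟨_, rfl⟩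
  have hR₂0 : 0 ≤ R₂ := by rw [hR₂]; positivity
  obtain ⟨S₃, hS₃⟩ : ∃ S, S = M * (2 * C₀ + 3 * R₁ + 2 * D₁ + 3 * R₂ + D₂) := ⟨_, rfl⟩
  have hS₃0 : 0 ≤ S₃ := by rw [hS₃]; positivity
  obtain ⟨R₃, hR₃⟩ : ∃ R, R = 2 ^ 3 * D₃ + S₃ + 2 * S₃ / α := ⟨_, rfl⟩
  have hR₃0 : 0 ≤ R₃ := by rw [hR₃]; positivity
  obtain ⟨T, hT⟩ : ∃ T, T = M * (2 * C₀ + R₁ + 2 * D₁ + D₂) := ⟨_, rfl⟩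
  have hT0 : 0 ≤ T := by rw [hT]; positivity
  refine ⟨1 + C₀ + D₁ + D₂ + R₁ + R₂ + R₃ + T, by positivity, ?_⟩
  intro ε₁ ε₂ hε₁ hlt hε₂1 w₁ w₂ hw₁ hw₂ hL h₁1 h₂1 hw0
  have hε₂ : 0 < ε₂ := hε₁.trans hlt
  have hε₁1 : ε₁ ≤ 1 := hlt.le.trans hε₂1
  have two_le : (2 : WithTop ℕ∞) ≤ 3 := by norm_num
  have one_le : (1 : WithTop ℕ∞) ≤ 3 := by norm_num
  have hw₁' : ContDiff ℝ (2 : ℕ) (deriv w₁) := contDiff_deriv_of_succ (by exact_mod_cast hw₁)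
  have hw₁'' : ContDiff ℝ (1 : ℕ) (deriv (deriv w₁)) := contDiff_deriv_of_succ hw₁'
  have hw₁0 := abs_le.1 ((le_max_left _ _).trans hw0)
  have hw₂0 := abs_le.1 ((le_max_right _ _).trans hw0)
  have hw : ∀ x ∈ Icc (0 : ℝ) 1,
      |w₁ x| ≤ C₀ * layer α ε₂ x ∧ |w₂ x| ≤ C₀ * layer α ε₂ x := by
    have key := fun s => layer_add_nonneg (s := s) hα hε₁ hlt.le hC₀ ha₁ ha₂
      (fun x hx => by linarith [hb₁ x hx]) (fun x hx => by linarith [hb₂ x hx]) hb₁₂ hb₂₁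
      (hw₁.of_le two_le) (hw₂.of_le two_le) (fun x hx => (hL x hx).1) (fun x hx => (hL x hx).2)
      h₁1 h₂1
    intro x hx
    obtain ⟨p₁, p₂⟩ := key 1 (by linarith) (by linarith) x hx
    obtain ⟨q₁, q₂⟩ := key (-1) (by linarith) (by linarith) x hx
    exact ⟨abs_le.2 ⟨by linarith, by linarith⟩, abs_le.2 ⟨by linarith, by linarith⟩⟩
  set f₁ : ℝ → ℝ := fun x => b₁₁ x * w₁ x - b₁₂ x * w₂ x with hf₁
  set f₂ : ℝ → ℝ := fun x => b₂₂ x * w₂ x - b₂₁ x * w₁ x with hf₂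
  have hf₁s : ContDiff ℝ 3 f₁ := (hb₁₁s.mul hw₁).sub (hb₁₂s.mul hw₂)
  have hf₂s : ContDiff ℝ 3 f₂ := (hb₂₂s.mul hw₂).sub (hb₂₁s.mul hw₁)
  have hode₁ := ode_and_deriv_on_Icc (ε := ε₁) (f := f₁) (ha₁s.of_le one_le) hw₁
    (hf₁s.of_le one_le) (fun x hx => by simp only [hf₁]; linarith [(hL x hx).1])
  have hode₂ := ode_and_deriv_on_Icc (ε := ε₂) (f := f₂) (ha₂s.of_le one_le) hw₂
    (hf₂s.of_le one_le) (fun x hx => by simp only [hf₂]; linarith [(hL x hx).2])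
  have hf₁b := abs_mul_sub_mul_derivs_le hb₁₁M hb₁₂M (hb₁₁s.of_le two_le) (hb₁₂s.of_le two_le)
    (hw₁.of_le two_le) (hw₂.of_le two_le)
  have hf₂b := abs_mul_sub_mul_derivs_le hb₂₂M hb₂₁M (hb₂₂s.of_le two_le) (hb₂₁s.of_le two_le)
    (hw₂.of_le two_le) (hw₁.of_le two_le)
  have hG₁ : ∀ x ∈ Icc (0 : ℝ) 1,
      |ε₁ * deriv (deriv w₁) x + a₁ x * deriv w₁ x| ≤ G * layer α ε₂ x := fun x hx => by
    rw [(hode₁ x hx).1, hG, mul_assoc, add_mul]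
    exact (hf₁b x hx).1.trans
      (mul_le_mul_of_nonneg_left (add_le_add (hw x hx).1 (hw x hx).2) hM0)
  have hG₂ : ∀ x ∈ Icc (0 : ℝ) 1,
      |ε₂ * deriv (deriv w₂) x + a₂ x * deriv w₂ x| ≤ G * layer α ε₂ x := fun x hx => by
    rw [(hode₂ x hx).1, hG, mul_assoc, add_mul]
    exact (hf₂b x hx).1.trans
      (mul_le_mul_of_nonneg_left (add_le_add (hw x hx).2 (hw x hx).1) hM0)
  have hd₁ := abs_deriv_le_of_layer hα.le hε₁ hlt.le hε₂1 hC₀ hM0 hG0 (ha₁s.of_le one_le)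
    (hw₁.of_le two_le) (fun x hx => (hw x hx).1) hG₁ (fun x hx => (ha₁M x hx).1)
    (fun x hx => (ha₁M x hx).2.1)
  have hd₂ := abs_deriv_le_of_layer hα.le hε₂ le_rfl hε₂1 hC₀ hM0 hG0 (ha₂s.of_le one_le)
    (hw₂.of_le two_le) (fun x hx => (hw x hx).2) hG₂ (fun x hx => (ha₂M x hx).1)
    (fun x hx => (ha₂M x hx).2.1)
  rw [← hD₁] at hd₁ hd₂
  have hdd₁ := abs_deriv_deriv_le_of_layer hε₁ hε₁1 hG0 (fun x hx => (ha₁M x hx).1) hG₁ hd₁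
  have hdd₂ := abs_deriv_deriv_le_of_layer hε₂ hε₂1 hG0 (fun x hx => (ha₂M x hx).1) hG₂ hd₂
  rw [← hD₂] at hdd₁ hdd₂
  have hddd₁ : ∀ x ∈ Icc (0 : ℝ) 1,
      |deriv (deriv (deriv w₁)) x| ≤ D₃ / ε₁ ^ 3 * layer α ε₂ x := by
    intro x hx
    have he := layer_pos α ε₂ x
    have e := (hode₁ x hx).2
    have p₀ := (hf₁b x hx).2.1
    have p₁ := abs_le.1 (abs_mul_le_mul_of_abs_le (ha₁M x hx).2.1 (hd₁ x hx))
    have p₂ := abs_le.1 (abs_mul_le_mul_of_abs_le (ha₁M x hx).1 (hdd₁ x hx))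
    have hi1 : 1 ≤ 1 / ε₁ := by rwa [le_div_iff₀ hε₁, one_mul]
    have hi2 : 1 / ε₁ ≤ 1 / ε₁ ^ 2 := by
      rw [pow_two]
      exact one_div_le_one_div_of_le (by positivity) (mul_le_of_le_one_left hε₁.le hε₁1)
    have hi3 : 1 / ε₂ ≤ 1 / ε₁ := one_div_le_one_div_of_le hε₁ hlt.le
    have c₀ : C₀ * layer α ε₂ x ≤ C₀ * layer α ε₂ x * (1 / ε₁ ^ 2) :=
      le_mul_of_one_le_right (by positivity) (hi1.trans hi2)
    have c₁ : D₁ / ε₁ * layer α ε₂ x ≤ D₁ * layer α ε₂ x * (1 / ε₁ ^ 2) :=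
      (show _ = D₁ * layer α ε₂ x * (1 / ε₁) by ring).trans_le
        (mul_le_mul_of_nonneg_left hi2 (by positivity))
    have c₂ : D₁ / ε₂ * layer α ε₂ x ≤ D₁ * layer α ε₂ x * (1 / ε₁ ^ 2) :=
      (show _ = D₁ * layer α ε₂ x * (1 / ε₂) by ring).trans_le
        (mul_le_mul_of_nonneg_left (hi3.trans hi2) (by positivity))
    have hsum : |w₁ x| + |deriv w₁ x| + |w₂ x| + |deriv w₂ x|
        ≤ (2 * C₀ + 2 * D₁) * layer α ε₂ x * (1 / ε₁ ^ 2) := by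
      linarith [(hw x hx).1, (hw x hx).2, hd₁ x hx, hd₂ x hx]
    have q₀ := abs_le.1 (p₀.trans (mul_le_mul_of_nonneg_left hsum hM0))
    have c₁' := mul_le_mul_of_nonneg_left c₁ hM0
    have h : ε₁ * |deriv (deriv (deriv w₁)) x| ≤ D₃ * layer α ε₂ x * (1 / ε₁ ^ 2) := by
      have habs : ε₁ * |deriv (deriv (deriv w₁)) x| = |ε₁ * deriv (deriv (deriv w₁)) x| := by
        rw [abs_mul, abs_of_pos hε₁]
      have p₂' : M * (D₂ / ε₁ ^ 2 * layer α ε₂ x) = M * D₂ * layer α ε₂ x * (1 / ε₁ ^ 2) := by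
        ring
      rw [p₂'] at p₂
      rw [habs, hD₃, abs_le]
      constructor <;> linarith [q₀.1, q₀.2, p₁.1, p₁.2, p₂.1, p₂.2]
    calc |deriv (deriv (deriv w₁)) x| ≤ D₃ * layer α ε₂ x * (1 / ε₁ ^ 2) / ε₁ := by
          rw [le_div_iff₀ hε₁]; linarith
      _ = _ := by field_simp
  have hE0 : ∀ k x, layer α ε₂ x ≤ layerSum α ε₁ ε₂ k x := fun k x => by
    simpa using layer_div_le_layerSum (α := α) (x := x) hε₁ hε₂ hε₂1 (Nat.zero_le k)
  have hw₂1 : ∀ k, 1 ≤ k → ∀ x ∈ Icc (0 : ℝ) 1, |deriv w₂ x| ≤ D₁ * layerSum α ε₁ ε₂ k x :=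
    fun k hk x hx => (hd₂ x hx).trans <| by
      rw [div_mul_eq_mul_div, mul_div_assoc]
      gcongr
      simpa using layer_div_le_layerSum (α := α) (x := x) hε₁ hε₂ hε₂1 hk
  have hr₁ : ∀ x ∈ Icc (0 : ℝ) 1, |deriv w₁ x| ≤ R₁ * layerSum α ε₁ ε₂ (0 + 1) x := by
    rw [hR₁]
    exact abs_le_layerSum_succ hα hε₁ hlt hε₂1 hG0 hD₁0 ha₁s.continuous ha₁
      hw₁'.continuous.continuousOn
      (fun x _ => (hw₁'.differentiable (by norm_num) x).hasDerivAt)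
      (fun x hx => (hG₁ x (Ioo_subset_Icc_self hx)).trans (by gcongr; exact hE0 0 x))
      (fun x hx => by simpa using hd₁ x hx)
  have hr₂ : ∀ x ∈ Icc (0 : ℝ) 1,
      |deriv (deriv w₁) x| ≤ R₂ * layerSum α ε₁ ε₂ (1 + 1) x := by
    rw [hR₂]
    refine abs_le_layerSum_succ hα hε₁ hlt hε₂1 hS₂0 hD₂0 ha₁s.continuous ha₁
      hw₁''.continuous.continuousOn
      (fun x _ => (hw₁''.differentiable (by norm_num) x).hasDerivAt) (fun x hx => ?_) hdd₁
    have hxI := Ioo_subset_Icc_self hx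
    rw [(hode₁ x hxI).2, hS₂]
    have p := abs_le.1 (hf₁b x hxI).2.1
    have q := abs_le.1 (abs_mul_le_mul_of_abs_le (ha₁M x hxI).2.1 (le_refl |deriv w₁ x|))
    have hsum : |w₁ x| + |deriv w₁ x| + |w₂ x| + |deriv w₂ x| + |deriv w₁ x|
        ≤ (2 * C₀ + 2 * R₁ + D₁) * layerSum α ε₁ ε₂ 1 x := by
      linarith [(hw x hxI).1, (hw x hxI).2, hr₁ x hxI, hw₂1 1 le_rfl x hxI,
        mul_le_mul_of_nonneg_left (hE0 1 x) hC₀]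
    have hsum' := mul_le_mul_of_nonneg_left hsum hM0
    rw [abs_le]
    constructor <;> linarith [p.1, p.2, q.1, q.2]
  have hr₃ : ∀ x ∈ Icc (0 : ℝ) 1,
      |deriv (deriv (deriv w₁)) x| ≤ R₃ * layerSum α ε₁ ε₂ 3 x := by
    rw [hR₃]
    refine abs_third_deriv_le_layerSum hα hε₁ hlt hε₂1 hS₃0 hD₃0 (ha₁s.of_le two_le) hw₁
      (hf₁s.of_le two_le) ha₁ (fun x hx => (hode₁ x hx).2) (fun x hx => ?_) hddd₁
    rw [hS₃]
    have p := abs_le.1 (hf₁b x hx).2.2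
    have q₁ := abs_le.1 (abs_mul_le_mul_of_abs_le (ha₁M x hx).2.2 (le_refl |deriv w₁ x|))
    have q₂ := abs_le.1 (abs_mul_le_mul_of_abs_le (ha₁M x hx).2.1 (le_refl |deriv (deriv w₁) x|))
    have hdd₂' : |deriv (deriv w₂) x| ≤ D₂ * layerSum α ε₁ ε₂ 2 x :=
      (hdd₂ x hx).trans <| by
        rw [div_mul_eq_mul_div, mul_div_assoc]
        gcongr
        exact layer_div_le_layerSum hε₁ hε₂ hε₂1 le_rfl
    have hr₁' : |deriv w₁ x| ≤ R₁ * layerSum α ε₁ ε₂ 2 x :=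
      (hr₁ x hx).trans (by gcongr; exact layerSum_le_succ 1 hε₁ hlt hε₂1)
    have hsum : |w₁ x| + 2 * |deriv w₁ x| + |deriv (deriv w₁) x|
          + |w₂ x| + 2 * |deriv w₂ x| + |deriv (deriv w₂) x| + |deriv w₁ x|
          + 2 * |deriv (deriv w₁) x|
        ≤ (2 * C₀ + 3 * R₁ + 2 * D₁ + 3 * R₂ + D₂) * layerSum α ε₁ ε₂ 2 x := by
      linarith [(hw x hx).1, (hw x hx).2, hr₁', hr₂ x hx, hw₂1 2 one_le_two x hx,
        mul_le_mul_of_nonneg_left (hE0 2 x) hC₀]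
    have hsum' := mul_le_mul_of_nonneg_left hsum hM0
    rw [abs_le]
    constructor <;> linarith [p.1, p.2, q₁.1, q₁.2, q₂.1, q₂.2]
  have ht : ∀ x ∈ Icc (0 : ℝ) 1, |deriv (deriv (deriv w₂)) x|
      ≤ T / ε₂ * (layer α ε₁ x / ε₁ + layer α ε₂ x / ε₂ ^ 2) := by
    intro x hx
    set X := layer α ε₁ x / ε₁ + layer α ε₂ x / ε₂ ^ 2 with hX
    have he₁ := layer_pos α ε₁ x
    have he₂ := layer_pos α ε₂ x
    have hX0 : layer α ε₂ x / ε₂ ^ 2 ≤ X := le_add_of_nonneg_left (by positivity)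
    have hX1 : layer α ε₂ x / ε₂ ≤ layer α ε₂ x / ε₂ ^ 2 :=
      div_le_div_of_nonneg_left he₂.le (by positivity)
        (by rw [pow_two]; exact mul_le_of_le_one_left hε₂.le hε₂1)
    have hX2 : layer α ε₂ x ≤ layer α ε₂ x / ε₂ := le_div_self he₂.le hε₂ hε₂1
    have hX3 : layerSum α ε₁ ε₂ (0 + 1) x ≤ X := by
      rw [layerSum, hX, zero_add, pow_one, pow_one]; linarith
    have c₀ : C₀ * layer α ε₂ x ≤ C₀ * X := by gcongr; linarith
    have c₁ : |deriv w₁ x| ≤ R₁ * X := (hr₁ x hx).trans (by gcongr)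
    have c₂ : |deriv w₂ x| ≤ D₁ * X := (hd₂ x hx).trans <| by
      rw [div_mul_eq_mul_div, mul_div_assoc]
      gcongr
      linarith
    have c₃ : |deriv (deriv w₂) x| ≤ D₂ * X := (hdd₂ x hx).trans <| by
      rw [div_mul_eq_mul_div, mul_div_assoc]
      gcongr
    have e := (hode₂ x hx).2
    have p := abs_le.1 (hf₂b x hx).2.1
    have q₁ := abs_le.1 (abs_mul_le_mul_of_abs_le (ha₂M x hx).2.1 (le_refl |deriv w₂ x|))
    have q₂ := abs_le.1 (abs_mul_le_mul_of_abs_le (ha₂M x hx).1 (le_refl |deriv (deriv w₂) x|))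
    have hsum : |w₂ x| + |deriv w₂ x| + |w₁ x| + |deriv w₁ x| + |deriv w₂ x|
        + |deriv (deriv w₂) x| ≤ (2 * C₀ + R₁ + 2 * D₁ + D₂) * X := by
      linarith [(hw x hx).1, (hw x hx).2]
    have hsum' := mul_le_mul_of_nonneg_left hsum hM0
    have h : ε₂ * |deriv (deriv (deriv w₂)) x| ≤ T * X := by
      have habs : ε₂ * |deriv (deriv (deriv w₂)) x| = |ε₂ * deriv (deriv (deriv w₂)) x| := by
        rw [abs_mul, abs_of_pos hε₂]
      rw [habs, hT, abs_le]
      constructor <;> linarith [p.1, p.2, q₁.1, q₁.2, q₂.1, q₂.2]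
    rw [div_mul_eq_mul_div, le_div_iff₀ hε₂]
    linarith
  intro x hx
  have he₁ := layer_pos α ε₁ x
  have he₂ := layer_pos α ε₂ x
  have hE : ∀ k, 0 ≤ layerSum α ε₁ ε₂ k x := fun k => he₂.le.trans (hE0 k x)
  have i2 : ∀ w : ℝ → ℝ, iteratedDeriv 2 w = deriv (deriv w) := fun w => by
    rw [iteratedDeriv_succ, iteratedDeriv_one]
  have i3 : ∀ w : ℝ → ℝ, iteratedDeriv 3 w = deriv (deriv (deriv w)) := fun w => by
    rw [iteratedDeriv_succ, i2]
  refine ⟨(hw x hx).1.trans ?_, (hw x hx).2.trans ?_, ?_, ?_, ?_⟩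
  · exact mul_le_mul_of_nonneg_right (by linarith) he₂.le
  · exact mul_le_mul_of_nonneg_right (by linarith) he₂.le
  · intro k hk1 hk3
    interval_cases k
    · rw [iteratedDeriv_one]
      exact (hr₁ x hx).trans (mul_le_mul_of_nonneg_right (by linarith) (hE 1))
    · rw [i2]
      exact (hr₂ x hx).trans (mul_le_mul_of_nonneg_right (by linarith) (hE 2))
    · rw [i3]
      exact (hr₃ x hx).trans (mul_le_mul_of_nonneg_right (by linarith) (hE 3))
  · intro k hk1 hk2
    interval_cases k
    · rw [iteratedDeriv_one, pow_one]
      refine (hd₂ x hx).trans ?_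
      rw [div_mul_eq_mul_div, mul_div_assoc]
      exact mul_le_mul_of_nonneg_right (by linarith) (by positivity)
    · rw [i2]
      refine (hdd₂ x hx).trans ?_
      rw [div_mul_eq_mul_div, mul_div_assoc]
      exact mul_le_mul_of_nonneg_right (by linarith) (by positivity)
  · rw [i3]
    refine (ht x hx).trans (mul_le_mul_of_nonneg_right ?_ (by positivity))
    gcongr
    linarith
end

section
/- Crossing points of the layer functions: Let B₁(x)=exp(−αx/ε₁) and B₂(x)=exp(−αx/ε₂) with 0<ε₁<ε₂ and α>0, and let s ∈ {1,2,3} with 2sε₂ ≤ α. Then there exists a unique point x_s ∈ (0,1/2) such that B₁(x_s)/ε₁ˢ = B₂(x_s)/ε₂ˢ; moreover B₁(x)/ε₁ˢ > B₂(x)/ε₂ˢ for x ∈ [0,x_s) and B₁(x)/ε₁ˢ < B₂(x)/ε₂ˢ for x ∈ (x_s,1]. -/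
open Set

theorem exp_div_pow_eq_exp_sub (a : ℝ) {ε : ℝ} (hε : 0 < ε) (s : ℕ) :
    Real.exp a / ε ^ s = Real.exp (a - s * Real.log ε) := by
  rw [Real.exp_sub, Real.exp_nat_mul, Real.exp_log hε]

/-- The difference of the logarithms of the two layer functions is linear in `x` and vanishes
at the crossing point. -/
theorem layer_exponent_sub (α ε₁ ε₂ x : ℝ) (s : ℕ)
    (hε₁ : 0 < ε₁) (hε₁₂ : ε₁ < ε₂) (hα : 0 < α) :
    (-(α * x) / ε₂ - s * Real.log ε₂) - (-(α * x) / ε₁ - s * Real.log ε₁) =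
      α * (ε₂ - ε₁) / (ε₁ * ε₂) *
        (x - s * (ε₁ * ε₂) * Real.log (ε₂ / ε₁) / (α * (ε₂ - ε₁))) := by
  have hε₂ : 0 < ε₂ := hε₁.trans hε₁₂
  have hsub : ε₂ - ε₁ ≠ 0 := (sub_pos.2 hε₁₂).ne'
  rw [Real.log_div hε₂.ne' hε₁.ne']
  field_simp
  ring

/-- Existence, uniqueness and separation property of the crossing point of the two
layer functions B₁/ε₁ˢ and B₂/ε₂ˢ. -/
theorem layer_crossing_point
    (α ε₁ ε₂ : ℝ) (s : ℕ)
    (hε₁ : 0 < ε₁) (hε₁₂ : ε₁ < ε₂) (hα : 0 < α)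
    (hs₁ : 1 ≤ s) (hs₃ : s ≤ 3) (hcond : 2 * (s : ℝ) * ε₂ ≤ α) :
    ∃ xs : ℝ, xs ∈ Ioo (0:ℝ) (1/2) ∧
      Real.exp (-(α * xs) / ε₁) / ε₁ ^ s = Real.exp (-(α * xs) / ε₂) / ε₂ ^ s ∧
      (∀ y ∈ Ioo (0:ℝ) (1/2),
        Real.exp (-(α * y) / ε₁) / ε₁ ^ s = Real.exp (-(α * y) / ε₂) / ε₂ ^ s → y = xs) ∧
      (∀ x ∈ Ico (0:ℝ) xs,
        Real.exp (-(α * x) / ε₂) / ε₂ ^ s < Real.exp (-(α * x) / ε₁) / ε₁ ^ s) ∧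
      (∀ x ∈ Ioc xs (1:ℝ),
        Real.exp (-(α * x) / ε₁) / ε₁ ^ s < Real.exp (-(α * x) / ε₂) / ε₂ ^ s) := by
  have hε₂ : 0 < ε₂ := hε₁.trans hε₁₂
  have hsub : 0 < ε₂ - ε₁ := sub_pos.2 hε₁₂
  have hs : (0 : ℝ) < s := by exact_mod_cast hs₁
  have hratio : 1 < ε₂ / ε₁ := (one_lt_div hε₁).2 hε₁₂
  have hlog_pos : 0 < Real.log (ε₂ / ε₁) := Real.log_pos hratio
  have hlog_lt : ε₁ * Real.log (ε₂ / ε₁) < ε₂ - ε₁ := by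
    have h := mul_lt_mul_of_pos_left
      (Real.log_lt_sub_one_of_pos (zero_lt_one.trans hratio) hratio.ne') hε₁
    rwa [mul_sub, mul_div_cancel₀ _ hε₁.ne', mul_one] at h
  have hslope : 0 < α * (ε₂ - ε₁) / (ε₁ * ε₂) := by positivity
  have hdiff := fun x => layer_exponent_sub α ε₁ ε₂ x s hε₁ hε₁₂ hα
  simp only [exp_div_pow_eq_exp_sub _ hε₁, exp_div_pow_eq_exp_sub _ hε₂, Real.exp_lt_exp,
    Real.exp_eq_exp]
  refine ⟨s * (ε₁ * ε₂) * Real.log (ε₂ / ε₁) / (α * (ε₂ - ε₁)), ⟨by positivity, ?_⟩,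
    ?_, ?_, ?_, ?_⟩
  · rw [div_lt_iff₀ (by positivity)]
    have h₁ := mul_lt_mul_of_pos_left hlog_lt (mul_pos hs hε₂)
    have h₂ := mul_le_mul_of_nonneg_right hcond hsub.le
    linarith
  · have h := hdiff (s * (ε₁ * ε₂) * Real.log (ε₂ / ε₁) / (α * (ε₂ - ε₁)))
    rw [sub_self, mul_zero] at h
    exact (sub_eq_zero.1 h).symm
  · intro y _ hy
    have h := hdiff y
    rw [hy, sub_self] at h
    exact sub_eq_zero.1 ((mul_eq_zero.1 h.symm).resolve_left hslope.ne')
  · intro x hx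
    rw [← sub_neg, hdiff]
    exact mul_neg_of_pos_of_neg hslope (sub_neg.2 hx.2)
  · intro x hx
    rw [← sub_pos, hdiff]
    exact mul_pos hslope (sub_pos.2 hx.1)
end

section
/- Improved estimates for the decomposed singular components: Let B₁(x)=exp(−αx/ε₁), B₂(x)=exp(−αx/ε₂) with 0<ε₁<ε₂, 6ε₂ ≤ α, and for s=1,3 let x_s ∈ (0,1/2) be the unique point with B₁(x_s)/ε₁ˢ = B₂(x_s)/ε₂ˢ. Suppose w₁, w₂ ∈ C³([0,1]) satisfy |w₁⁽ᵏ⁾(x)| ≤ C₀(ε₁⁻ᵏB₁(x)+ε₂⁻ᵏB₂(x)) for k=2,3, |w₂⁽ᵏ⁾(x)| ≤ C₀ε₂⁻ᵏB₂(x) for k=2, and |w₂⁽³⁾(x)| ≤ C₀ε₂⁻¹(ε₁⁻¹B₁(x)+ε₂⁻²B₂(x)). Define w₁₁(x) = Σ_{k=0}^{3}((x−x₃)ᵏ/k!)w₁⁽ᵏ⁾(x₃) for x ∈ [0,x₃) and w₁₁(x)=w₁(x) for x ∈ [x₃,1]; w₁₂ = w₁−w₁₁; w₂₁(x) = Σ_{k=0}^{3}((x−x₁)ᵏ/k!)w₂⁽ᵏ⁾(x₁)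 for x ∈ [0,x₁) and w₂₁(x)=w₂(x) for x ∈ [x₁,1]; w₂₂ = w₂−w₂₁. Then there is a constant C (depending only on C₀ and α) such that for all x ∈ [0,1]: |w₁₁⁽³⁾(x)| ≤ Cε₂⁻³B₂(x), |w₁₂''(x)| ≤ Cε₁⁻²B₁(x), |w₂₁⁽³⁾(x)| ≤ Cε₂⁻³B₂(x), |w₂₂''(x)| ≤ Cε₂⁻²B₁(x). -/
open Set

/-- Derivatives of two functions glued at a point where all their derivatives agree. -/
lemma iteratedDeriv_ite_lt {n : ℕ} {f g : ℝ → ℝ} {a : ℝ} (hf : ContDiff ℝ n f)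
    (hg : ContDiff ℝ n g) (hfg : ∀ k ≤ n, iteratedDeriv k f a = iteratedDeriv k g a) :
    ∀ k ≤ n, iteratedDeriv k (fun x => if x < a then f x else g x) =
      fun x => if x < a then iteratedDeriv k f x else iteratedDeriv k g x := by
  intro k
  induction k with
  | zero => simp
  | succ k ih =>
    intro hk
    have hdf : Differentiable ℝ (iteratedDeriv k f) :=
      hf.differentiable_iteratedDeriv k (by exact_mod_cast hk)
    have hdg : Differentiable ℝ (iteratedDeriv k g) :=
      hg.differentiable_iteratedDeriv k (by exact_mod_cast hk)
    rw [iteratedDeriv_succ, ih (by omega)]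
    funext x
    rcases lt_trichotomy x a with hx | rfl | hx
    · rw [if_pos hx, iteratedDeriv_succ]
      apply Filter.EventuallyEq.deriv_eq
      filter_upwards [eventually_lt_nhds hx] with y hy
      exact if_pos hy
    · rw [if_neg (lt_irrefl x)]
      have h1 : HasDerivAt (iteratedDeriv k f) (iteratedDeriv (k + 1) g x) x := by
        rw [← hfg (k + 1) hk, iteratedDeriv_succ]
        exact (hdf x).hasDerivAt
      have h2 : HasDerivAt (iteratedDeriv k g) (iteratedDeriv (k + 1) g x) x := by
        rw [iteratedDeriv_succ]
        exact (hdg x).hasDerivAt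
      have hl := h1.hasDerivWithinAt.congr_of_mem (s := Iic x)
        (f₁ := fun y => if y < x then iteratedDeriv k f y else iteratedDeriv k g y)
        (fun y hy => by
          rcases eq_or_lt_of_le (mem_Iic.1 hy) with rfl | hy
          · simp [hfg k (by omega)]
          · simp [hy]) self_mem_Iic
      have hr := h2.hasDerivWithinAt.congr_of_mem (s := Ici x)
        (f₁ := fun y => if y < x then iteratedDeriv k f y else iteratedDeriv k g y)
        (fun y hy => if_neg (not_lt.2 hy)) self_mem_Ici
      have h := hl.union hr
      rw [Iic_union_Ici, hasDerivWithinAt_univ] at h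
      exact h.deriv
    · rw [if_neg hx.not_gt, iteratedDeriv_succ]
      apply Filter.EventuallyEq.deriv_eq
      filter_upwards [eventually_gt_nhds hx] with y hy
      exact if_neg hy.not_gt

lemma hasDerivAt_sum_pow_div_factorial (n : ℕ) (c : ℕ → ℝ) (a x : ℝ) :
    HasDerivAt (fun x => ∑ k ∈ Finset.range (n + 1), (x - a) ^ k / (Nat.factorial k : ℝ) * c k)
      (∑ k ∈ Finset.range n, (x - a) ^ k / (Nat.factorial k : ℝ) * c (k + 1)) x := by
  simp only [Finset.sum_range_succ' _ n, pow_zero, Nat.factorial_zero, Nat.cast_one, div_one, one_mul]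
  refine HasDerivAt.add_const _ (HasDerivAt.fun_sum fun k _ => ?_)
  have h := ((((hasDerivAt_id x).sub_const a).fun_pow (k + 1)).div_const
    (Nat.factorial (k + 1) : ℝ)).mul_const (c (k + 1))
  refine h.congr_deriv ?_
  have h1 : (Nat.factorial k : ℝ) ≠ 0 := by positivity
  have h2 : (k + 1 : ℝ) ≠ 0 := by positivity
  simp only [id, Nat.factorial_succ, Nat.cast_mul, Nat.cast_add, Nat.cast_one, mul_one,
    Nat.add_sub_cancel]
  field_simp

lemma iteratedDeriv_sum_pow_div_factorial (j m : ℕ) (c : ℕ → ℝ) (a : ℝ) :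
    iteratedDeriv j
        (fun x => ∑ k ∈ Finset.range (m + j), (x - a) ^ k / (Nat.factorial k : ℝ) * c k) =
      fun x => ∑ k ∈ Finset.range m, (x - a) ^ k / (Nat.factorial k : ℝ) * c (k + j) := by
  induction j generalizing m with
  | zero => simp
  | succ j ih =>
    rw [iteratedDeriv_succ, show m + (j + 1) = (m + 1) + j by ring, ih (m + 1)]
    funext x
    rw [(hasDerivAt_sum_pow_div_factorial m (fun k => c (k + j)) a x).deriv]
    exact Finset.sum_congr rfl fun k _ => by rw [add_right_comm, add_assoc]

lemma iteratedDeriv_sum_pow_div_factorial_self {n j : ℕ} (hj : j < n) (c : ℕ → ℝ) (a : ℝ) :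
    iteratedDeriv j
        (fun x => ∑ k ∈ Finset.range n, (x - a) ^ k / (Nat.factorial k : ℝ) * c k) a = c j := by
  obtain ⟨m, rfl⟩ : ∃ m, n = (m + 1) + j := ⟨n - j - 1, by omega⟩
  rw [iteratedDeriv_sum_pow_div_factorial]
  simp [Finset.sum_range_succ']

/-- A function vanishing at `a` whose derivative decays exponentially is controlled on the left
of `a`. -/
lemma abs_le_of_abs_deriv_le_exp {f f' : ℝ → ℝ} {x a c K : ℝ} (hxa : x ≤ a) (hK : 0 ≤ K)
    (hf : ∀ t, HasDerivAt f (f' t) t) (ha : f a = 0)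
    (hb : ∀ t ∈ Icc x a, |f' t| ≤ K * c * Real.exp (-(c * t))) :
    |f x| ≤ K * Real.exp (-(c * x)) := by
  have hexp : ∀ t, HasDerivAt (fun t => K * Real.exp (-(c * t)))
      (-(K * c * Real.exp (-(c * t)))) t := fun t => by
    have h := (((hasDerivAt_id t).const_mul c).neg.exp).const_mul K
    refine h.congr_deriv ?_
    simp only [id, Pi.neg_apply]
    ring
  have key : ∀ g g' : ℝ → ℝ, (∀ t, HasDerivAt g (g' t) t) → g a = 0 →
      (∀ t ∈ Icc x a, g' t ≤ K * c * Real.exp (-(c * t))) →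
      0 ≤ K * Real.exp (-(c * x)) + g x := by
    intro g g' hg hga hgb
    have hd := fun t => (hexp t).fun_add (hg t)
    have hanti : AntitoneOn (fun t => K * Real.exp (-(c * t)) + g t) (Icc x a) := by
      refine antitoneOn_of_deriv_nonpos (convex_Icc x a)
        (fun t _ => (hd t).continuousAt.continuousWithinAt)
        (fun t _ => (hd t).differentiableAt.differentiableWithinAt) fun t ht => ?_
      rw [(hd t).deriv]
      linarith [hgb t (interior_subset ht)]
    have h := hanti (left_mem_Icc.2 hxa) (right_mem_Icc.2 hxa) hxa
    simp only [hga, add_zero] at h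
    exact le_trans (by positivity) h
  have h1 := key f f' hf ha fun t ht => (le_abs_self _).trans (hb t ht)
  have h2 := key (fun t => -f t) (fun t => -f' t) (fun t => (hf t).fun_neg) (by simp [ha])
    fun t ht => (neg_le_abs _).trans (hb t ht)
  exact abs_le.2 ⟨by linarith, by linarith⟩

lemma hasDerivAt_iteratedDeriv {n k : ℕ} {f : ℝ → ℝ} (hf : ContDiff ℝ n f) (hk : k < n) (t : ℝ) :
    HasDerivAt (iteratedDeriv k f) (iteratedDeriv (k + 1) f t) t := by
  rw [iteratedDeriv_succ]
  exact (hf.differentiable_iteratedDeriv k (by exact_mod_cast hk) t).hasDerivAt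

/-- Replacing `w` to the left of `a` by its cubic Taylor polynomial at `a`. -/
lemma iteratedDeriv_taylor_extension {w u v : ℝ → ℝ} {a : ℝ} (hw : ContDiff ℝ 3 w)
    (hu : ∀ x, u x = if x < a then
      ∑ k ∈ Finset.range 4, (x - a) ^ k / (Nat.factorial k : ℝ) * iteratedDeriv k w a else w x)
    (hv : ∀ x, v x = w x - u x) (x : ℝ) :
    iteratedDeriv 3 u x = iteratedDeriv 3 w (max x a) ∧
    (a ≤ x → iteratedDeriv 2 v x = 0) ∧
    ∀ K c : ℝ, 0 ≤ K → 0 ≤ c → x < a →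
      (∀ t ∈ Icc x a, |iteratedDeriv 3 w t| ≤ K * c / 2 * Real.exp (-(c * t))) →
      |iteratedDeriv 2 v x| ≤ K * Real.exp (-(c * x)) := by
  set p : ℝ → ℝ := fun x =>
    ∑ k ∈ Finset.range 4, (x - a) ^ k / (Nat.factorial k : ℝ) * iteratedDeriv k w a with hp
  have hw' : ContDiff ℝ (3 : ℕ) w := by exact_mod_cast hw
  have hpc : ContDiff ℝ (3 : ℕ) p := by
    rw [hp]
    fun_prop
  have hpa : ∀ k ≤ 3, iteratedDeriv k p a = iteratedDeriv k w a := fun k hk =>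
    iteratedDeriv_sum_pow_div_factorial_self (by omega) (fun k => iteratedDeriv k w a) a
  have hp3 : ∀ t, iteratedDeriv 3 p t = iteratedDeriv 3 w a := fun t => by
    rw [hp, iteratedDeriv_sum_pow_div_factorial 3 1 (fun k => iteratedDeriv k w a) a]
    simp
  have hu' : u = fun x => if x < a then p x else w x := funext hu
  have hv' : v = fun x => if x < a then (w - p) x else (fun _ => (0 : ℝ)) x := by
    funext y
    rw [hv, hu']
    by_cases hy : y < a <;> simp [hy]
  have hsub : ∀ k ≤ 3, ∀ t, iteratedDeriv k (w - p) t =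
      iteratedDeriv k w t - iteratedDeriv k p t := fun k hk t =>
    iteratedDeriv_sub ((hw'.of_le (by exact_mod_cast hk)).contDiffAt)
      ((hpc.of_le (by exact_mod_cast hk)).contDiffAt)
  have hwp : ContDiff ℝ (3 : ℕ) (w - p) := hw'.sub hpc
  have hv2 := iteratedDeriv_ite_lt hwp (contDiff_const (c := (0 : ℝ)))
    (fun k hk => by rw [hsub k hk, hpa k hk]; simp) 2 (by norm_num)
  rw [← hv'] at hv2
  refine ⟨?_, fun hx => ?_, fun K c hK hc hx hb => ?_⟩
  · rw [hu', iteratedDeriv_ite_lt hpc hw' hpa 3 le_rfl]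
    by_cases hx : x < a
    · simp only [hx, if_true, hp3, max_eq_right hx.le]
    · simp only [hx, if_false, max_eq_left (not_lt.1 hx)]
  · simp [hv2, hx.not_gt]
  · rw [hv2]
    simp only [hx, if_true]
    refine abs_le_of_abs_deriv_le_exp hx.le hK
      (fun t => hasDerivAt_iteratedDeriv hwp (by norm_num) t)
      (by rw [hsub 2 (by norm_num), hpa 2 (by norm_num), sub_self]) fun t ht => ?_
    rw [hsub 3 le_rfl, hp3]
    have h1 := hb t ht
    have h2 := hb a (right_mem_Icc.2 hx.le)
    have h3 : K * c / 2 * Real.exp (-(c * a)) ≤ K * c / 2 * Real.exp (-(c * t)) := by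
      have := ht.2
      gcongr
    calc _ ≤ |iteratedDeriv 3 w t| + |iteratedDeriv 3 w a| := abs_sub _ _
      _ ≤ _ := by linarith

/-- Two scaled boundary layer functions that meet at `a` are ordered on either side of `a`. -/
lemma layer_le_of_crossing {α ε₁ ε₂ p q a : ℝ} (hα : 0 < α) (hε₁ : 0 < ε₁) (hε : ε₁ < ε₂)
    (hp : 0 < p)
    (h : Real.exp (-(α * a) / ε₁) / p = Real.exp (-(α * a) / ε₂) / q) (x : ℝ) :
    (a ≤ x → Real.exp (-(α * x) / ε₁) / p ≤ Real.exp (-(α * x) / ε₂) / q) ∧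
    (x ≤ a → Real.exp (-(α * x) / ε₂) / q ≤ Real.exp (-(α * x) / ε₁) / p) := by
  have hsplit : ∀ e r : ℝ, Real.exp (-(α * x) / e) / r =
      Real.exp (-(α * a) / e) / r * Real.exp (α * (a - x) / e) := fun e r => by
    rw [div_mul_eq_mul_div, ← Real.exp_add]
    congr 2
    ring
  have hinv : ε₂⁻¹ ≤ ε₁⁻¹ := inv_anti₀ hε₁ hε.le
  rw [hsplit ε₁ p, hsplit ε₂ q, ← h]
  constructor <;> intro hx <;> gcongr ?_ * Real.exp ?_ <;>
    rw [div_eq_mul_inv, div_eq_mul_inv]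
  · exact mul_le_mul_of_nonpos_left hinv
      (mul_nonpos_of_nonneg_of_nonpos hα.le (sub_nonpos.2 hx))
  · exact mul_le_mul_of_nonneg_left hinv (mul_nonneg hα.le (sub_nonneg.2 hx))


/-- Improved estimates for the decomposed singular components w₁₁, w₁₂, w₂₁, w₂₂. -/
theorem improved_singular_estimates
    (C₀ α : ℝ) (hC₀ : 0 ≤ C₀) (hα : 0 < α) :
    ∃ C : ℝ, 0 < C ∧
      ∀ ε₁ ε₂ xc₁ xc₃ : ℝ, 0 < ε₁ → ε₁ < ε₂ → 6 * ε₂ ≤ α →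
      xc₁ ∈ Ioo (0:ℝ) (1/2) →
      Real.exp (-(α * xc₁) / ε₁) / ε₁ = Real.exp (-(α * xc₁) / ε₂) / ε₂ →
      xc₃ ∈ Ioo (0:ℝ) (1/2) →
      Real.exp (-(α * xc₃) / ε₁) / ε₁ ^ 3 = Real.exp (-(α * xc₃) / ε₂) / ε₂ ^ 3 →
      ∀ w₁ w₂ w₁₁ w₁₂ w₂₁ w₂₂ : ℝ → ℝ,
        ContDiff ℝ 3 w₁ → ContDiff ℝ 3 w₂ →
        (∀ k : ℕ, k = 2 ∨ k = 3 → ∀ x ∈ Icc (0:ℝ) 1,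
          |iteratedDeriv k w₁ x| ≤
            C₀ * (Real.exp (-(α * x) / ε₁) / ε₁ ^ k + Real.exp (-(α * x) / ε₂) / ε₂ ^ k)) →
        (∀ x ∈ Icc (0:ℝ) 1,
          |iteratedDeriv 2 w₂ x| ≤ C₀ * (Real.exp (-(α * x) / ε₂) / ε₂ ^ 2)) →
        (∀ x ∈ Icc (0:ℝ) 1,
          |iteratedDeriv 3 w₂ x| ≤
            C₀ / ε₂ * (Real.exp (-(α * x) / ε₁) / ε₁ + Real.exp (-(α * x) / ε₂) / ε₂ ^ 2)) →
        (∀ x : ℝ, w₁₁ x = if x < xc₃ then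
            ∑ k ∈ Finset.range 4, (x - xc₃) ^ k / (Nat.factorial k : ℝ) * iteratedDeriv k w₁ xc₃
          else w₁ x) →
        (∀ x : ℝ, w₁₂ x = w₁ x - w₁₁ x) →
        (∀ x : ℝ, w₂₁ x = if x < xc₁ then
            ∑ k ∈ Finset.range 4, (x - xc₁) ^ k / (Nat.factorial k : ℝ) * iteratedDeriv k w₂ xc₁
          else w₂ x) →
        (∀ x : ℝ, w₂₂ x = w₂ x - w₂₁ x) →
        ∀ x ∈ Icc (0:ℝ) 1,
          |iteratedDeriv 3 w₁₁ x| ≤ C * (Real.exp (-(α * x) / ε₂) / ε₂ ^ 3) ∧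
          |iteratedDeriv 2 w₁₂ x| ≤ C * (Real.exp (-(α * x) / ε₁) / ε₁ ^ 2) ∧
          |iteratedDeriv 3 w₂₁ x| ≤ C * (Real.exp (-(α * x) / ε₂) / ε₂ ^ 3) ∧
          |iteratedDeriv 2 w₂₂ x| ≤ C * (Real.exp (-(α * x) / ε₁) / ε₂ ^ 2) := by
  refine ⟨1 + 2 * C₀ + C₀ * (1 + α) + 4 * C₀ / α + 2 * C₀ * (1 + α) / α, by positivity, ?_⟩
  intro ε₁ ε₂ xc₁ xc₃ hε₁ hε hε₂α hxc₁ heq₁ hxc₃ heq₃ w₁ w₂ w₁₁ w₁₂ w₂₁ w₂₂ hw₁ hw₂ hb₁ _ hb₂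
    hw₁₁ hw₁₂ hw₂₁ hw₂₂ x hx
  have hε₂ : 0 < ε₂ := hε₁.trans hε
  set C := 1 + 2 * C₀ + C₀ * (1 + α) + 4 * C₀ / α + 2 * C₀ * (1 + α) / α with hC
  have p1 : 0 ≤ C₀ * (1 + α) := by positivity
  have p2 : 0 ≤ 4 * C₀ / α := by positivity
  have p3 : 0 ≤ 2 * C₀ * (1 + α) / α := by positivity
  have hcross₁ := layer_le_of_crossing hα hε₁ hε hε₁ heq₁
  have hcross₃ := layer_le_of_crossing hα hε₁ hε (pow_pos hε₁ 3) heq₃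
  have hB : ∀ ε t : ℝ, Real.exp (-(α * t) / ε) = Real.exp (-(α / ε * t)) := fun ε t => by
    congr 1
    ring
  have hmono : ∀ y, x ≤ y → Real.exp (-(α * y) / ε₂) ≤ Real.exp (-(α * x) / ε₂) := fun y hy => by
    gcongr
  have hmem : ∀ a ∈ Ioo (0 : ℝ) (1 / 2), max x a ∈ Icc (0 : ℝ) 1 := fun a ha =>
    ⟨hx.1.trans (le_max_left _ _), max_le hx.2 (by linarith [ha.2])⟩
  have hsub : ∀ a ∈ Ioo (0 : ℝ) (1 / 2), ∀ t ∈ Icc x a, t ∈ Icc (0 : ℝ) 1 := fun a ha t ht =>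
    ⟨hx.1.trans ht.1, by linarith [ha.2, ht.2]⟩
  obtain ⟨hu₁, hv₁, hv₁'⟩ := iteratedDeriv_taylor_extension hw₁ hw₁₁ hw₁₂ x
  obtain ⟨hu₂, hv₂, hv₂'⟩ := iteratedDeriv_taylor_extension hw₂ hw₂₁ hw₂₂ x
  refine ⟨?_, ?_, ?_, ?_⟩
  · rw [hu₁]
    calc |iteratedDeriv 3 w₁ (max x xc₃)|
        ≤ C₀ * (Real.exp (-(α * max x xc₃) / ε₁) / ε₁ ^ 3 +
            Real.exp (-(α * max x xc₃) / ε₂) / ε₂ ^ 3) := hb₁ 3 (Or.inr rfl) _ (hmem _ hxc₃)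
      _ ≤ C₀ * (Real.exp (-(α * max x xc₃) / ε₂) / ε₂ ^ 3 +
            Real.exp (-(α * max x xc₃) / ε₂) / ε₂ ^ 3) := by
          gcongr C₀ * (?_ + _)
          exact (hcross₃ _).1 (le_max_right _ _)
      _ = 2 * C₀ * (Real.exp (-(α * max x xc₃) / ε₂) / ε₂ ^ 3) := by ring
      _ ≤ C * (Real.exp (-(α * x) / ε₂) / ε₂ ^ 3) := by
          gcongr ?_ * (?_ / _)
          · linarith
          · exact hmono _ (le_max_left _ _)
  · rcases le_or_gt xc₃ x with hxa | hxa
    · rw [hv₁ hxa, abs_zero]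
      positivity
    · refine (hv₁' (4 * C₀ / α / ε₁ ^ 2) (α / ε₁) (by positivity) (by positivity) hxa
        fun t ht => ?_).trans ?_
      · calc |iteratedDeriv 3 w₁ t|
            ≤ C₀ * (Real.exp (-(α * t) / ε₁) / ε₁ ^ 3 + Real.exp (-(α * t) / ε₂) / ε₂ ^ 3) :=
              hb₁ 3 (Or.inr rfl) _ (hsub _ hxc₃ t ht)
          _ ≤ C₀ * (Real.exp (-(α * t) / ε₁) / ε₁ ^ 3 + Real.exp (-(α * t) / ε₁) / ε₁ ^ 3) := by
              gcongr C₀ * (_ + ?_)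
              exact (hcross₃ t).2 ht.2
          _ = _ := by
              rw [hB]
              field_simp
              ring
      · rw [← hB, div_mul_eq_mul_div, mul_div_assoc]
        gcongr
        linarith
  · rw [hu₂]
    calc |iteratedDeriv 3 w₂ (max x xc₁)|
        ≤ C₀ / ε₂ * (Real.exp (-(α * max x xc₁) / ε₁) / ε₁ +
            Real.exp (-(α * max x xc₁) / ε₂) / ε₂ ^ 2) := hb₂ _ (hmem _ hxc₁)
      _ ≤ C₀ / ε₂ * (Real.exp (-(α * max x xc₁) / ε₂) / ε₂ +
            Real.exp (-(α * max x xc₁) / ε₂) / ε₂ ^ 2) := by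
          gcongr C₀ / ε₂ * (?_ + _)
          exact (hcross₁ _).1 (le_max_right _ _)
      _ = C₀ * (1 + ε₂) * (Real.exp (-(α * max x xc₁) / ε₂) / ε₂ ^ 3) := by
          field_simp
          ring
      _ ≤ C₀ * (1 + α) * (Real.exp (-(α * x) / ε₂) / ε₂ ^ 3) := by
          gcongr ?_ * (1 + ?_) * (?_ / _)
          · linarith
          · exact hmono _ (le_max_left _ _)
      _ ≤ C * (Real.exp (-(α * x) / ε₂) / ε₂ ^ 3) := by
          gcongr
          linarith
  · rcases le_or_gt xc₁ x with hxa | hxa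
    · rw [hv₂ hxa, abs_zero]
      positivity
    · refine (hv₂' (2 * C₀ * (1 + ε₂) / α / ε₂ ^ 2) (α / ε₁) (by positivity) (by positivity) hxa
        fun t ht => ?_).trans ?_
      · calc |iteratedDeriv 3 w₂ t|
            ≤ C₀ / ε₂ * (Real.exp (-(α * t) / ε₁) / ε₁ + Real.exp (-(α * t) / ε₂) / ε₂ ^ 2) :=
              hb₂ _ (hsub _ hxc₁ t ht)
          _ = C₀ / ε₂ * (Real.exp (-(α * t) / ε₁) / ε₁ +
                Real.exp (-(α * t) / ε₂) / ε₂ / ε₂) := by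
              rw [div_div _ ε₂ ε₂, sq]
          _ ≤ C₀ / ε₂ * (Real.exp (-(α * t) / ε₁) / ε₁ +
                Real.exp (-(α * t) / ε₁) / ε₁ / ε₂) := by
              gcongr ?_ * (_ + ?_ / _)
              exact (hcross₁ t).2 ht.2
          _ = _ := by
              rw [hB]
              field_simp
              ring
      · rw [← hB, div_mul_eq_mul_div, mul_div_assoc]
        gcongr
        calc 2 * C₀ * (1 + ε₂) / α ≤ 2 * C₀ * (1 + α) / α := by
              gcongr
              linarith
          _ ≤ C := by linarith
end

section
/- Alternate decomposition estimates: Let B₁(x)=exp(−αx/ε₁), B₂(x)=exp(−αx/ε₂) with 0<ε₁<ε₂, 4ε₂ ≤ α, and let x₂ ∈ (0,1/2) be the unique point with B₁(x₂)/ε₁² = B₂(x₂)/ε₂². Suppose w₁ ∈ C²([0,1]) satisfies |w₁⁽ᵏ⁾(x)| ≤ C₀(ε₁⁻ᵏB₁(x)+ε₂⁻ᵏB₂(x)) for k=1,2. Define w₁₁(x) = Σ_{k=0}^{2}((x−x₂)ᵏ/k!)w₁⁽ᵏ⁾(x₂) for x ∈ [0,x₂) and w₁₁(x)=w₁(x)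 for x ∈ [x₂,1], and w₁₂ = w₁−w₁₁. Then there is a constant C (depending only on C₀ and α) such that for all x ∈ [0,1]: |w₁₁''(x)| ≤ Cε₂⁻²B₂(x) and |w₁₂'(x)| ≤ Cε₁⁻¹B₁(x). -/
open Set

/-- Two differentiable functions that agree to first order at `c` can be glued there. -/
theorem hasDerivAt_ite_lt {p q p' q' : ℝ → ℝ} {c : ℝ}
    (hp : ∀ x, HasDerivAt p (p' x) x) (hq : ∀ x, HasDerivAt q (q' x) x)
    (h₀ : p c = q c) (h₁ : p' c = q' c) (x : ℝ) :
    HasDerivAt (fun y => if y < c then p y else q y) (if x < c then p' x else q' x) x := by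
  rcases lt_trichotomy x c with hx | rfl | hx
  · rw [if_pos hx]
    refine (hp x).congr_of_eventuallyEq ?_
    filter_upwards [Iio_mem_nhds hx] with y hy
    exact if_pos hy
  · rw [if_neg (lt_irrefl x), ← hasDerivWithinAt_univ, ← Iic_union_Ici (a := x)]
    refine HasDerivWithinAt.union ?_ ?_
    · rw [← h₁]
      refine (hp x).hasDerivWithinAt.congr (fun y hy => ?_) (by simp [h₀])
      rcases (mem_Iic.1 hy).lt_or_eq with h | rfl
      · exact if_pos h
      · simp [h₀]
    · exact (hq x).hasDerivWithinAt.congr (fun y hy => if_neg (not_lt.2 hy)) (by simp)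
  · rw [if_neg hx.not_gt]
    refine (hq x).congr_of_eventuallyEq ?_
    filter_upwards [Ioi_mem_nhds hx] with y hy
    exact if_neg (not_lt.2 (le_of_lt hy))

theorem exp_layer_eq_mul (α ε x c : ℝ) (k : ℕ) :
    Real.exp (-(α * x) / ε) / ε ^ k =
      Real.exp (-(α * c) / ε) / ε ^ k * Real.exp (α * (c - x) / ε) := by
  rw [div_mul_eq_mul_div, ← Real.exp_add]
  ring_nf

theorem exp_layer_antitone {α ε : ℝ} (hα : 0 < α) (hε : 0 < ε) (k : ℕ) :
    Antitone fun x : ℝ => Real.exp (-(α * x) / ε) / ε ^ k := by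
  intro x y hxy
  dsimp only
  gcongr

/-- Left of the crossing point the layer with the smaller parameter dominates. -/
theorem exp_layer_le_of_le_crossing {α ε₁ ε₂ c x : ℝ} {k : ℕ} (hα : 0 < α) (hε₁ : 0 < ε₁)
    (hε : ε₁ < ε₂)
    (hc : Real.exp (-(α * c) / ε₁) / ε₁ ^ k = Real.exp (-(α * c) / ε₂) / ε₂ ^ k) (hx : x ≤ c) :
    Real.exp (-(α * x) / ε₂) / ε₂ ^ k ≤ Real.exp (-(α * x) / ε₁) / ε₁ ^ k := by
  rw [exp_layer_eq_mul α ε₂ x c, exp_layer_eq_mul α ε₁ x c, hc]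
  have hcx : 0 ≤ c - x := sub_nonneg.2 hx
  have hε₂ : 0 < ε₂ := hε₁.trans hε
  gcongr

/-- Right of the crossing point the layer with the larger parameter dominates. -/
theorem exp_layer_le_of_crossing_le {α ε₁ ε₂ c x : ℝ} {k : ℕ} (hα : 0 < α) (hε₁ : 0 < ε₁)
    (hε : ε₁ < ε₂)
    (hc : Real.exp (-(α * c) / ε₁) / ε₁ ^ k = Real.exp (-(α * c) / ε₂) / ε₂ ^ k) (hx : c ≤ x) :
    Real.exp (-(α * x) / ε₁) / ε₁ ^ k ≤ Real.exp (-(α * x) / ε₂) / ε₂ ^ k := by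
  rw [exp_layer_eq_mul α ε₂ x c, exp_layer_eq_mul α ε₁ x c, hc]
  have hε₂ : 0 < ε₂ := hε₁.trans hε
  refine mul_le_mul_of_nonneg_left (Real.exp_le_exp.2 ?_) (by positivity)
  rw [div_le_div_iff₀ hε₁ hε₂]
  exact mul_le_mul_of_nonpos_left hε.le (mul_nonpos_of_nonneg_of_nonpos hα.le (sub_nonpos.2 hx))

theorem hasDerivAt_exp_layer (α ε x : ℝ) :
    HasDerivAt (fun x : ℝ => Real.exp (-(α * x) / ε)) (-(α / ε) * Real.exp (-(α * x) / ε)) x := by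
  have h : HasDerivAt (fun x : ℝ => -(α * x) / ε) (-(α * 1) / ε) x :=
    ((hasDerivAt_id x).const_mul α).neg.div_const ε
  convert h.exp using 1
  ring

/-- A function vanishing at the right end point is bounded by any nonnegative function that
decreases faster than it varies. -/
theorem abs_le_of_abs_deriv_le_neg_deriv {h g h' g' : ℝ → ℝ} {x c : ℝ}
    (hh : ∀ t, HasDerivAt h (h' t) t) (hg : ∀ t, HasDerivAt g (g' t) t) (hxc : x ≤ c)
    (hbound : ∀ t ∈ Icc x c, |h' t| ≤ -g' t) (hhc : h c = 0) (hgc : 0 ≤ g c) :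
    |h x| ≤ g x := by
  have key : ∀ {f f' : ℝ → ℝ}, (∀ t, HasDerivAt f (f' t) t) → (∀ t ∈ Icc x c, f' t ≤ 0) →
      f c ≤ f x := fun {f f'} hf hf' =>
    antitoneOn_of_hasDerivWithinAt_nonpos (convex_Icc x c)
      (fun t _ => (hf t).continuousAt.continuousWithinAt)
      (fun t _ => (hf t).hasDerivWithinAt) (fun t ht => hf' t (interior_subset ht))
      (left_mem_Icc.2 hxc) (right_mem_Icc.2 hxc) hxc
  have h₁ : g c + h c ≤ g x + h x := key (fun t => (hg t).add (hh t)) fun t ht => by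
    linarith [(abs_le.1 (hbound t ht)).2]
  have h₂ : g c - h c ≤ g x - h x := key (fun t => (hg t).sub (hh t)) fun t ht => by
    linarith [(abs_le.1 (hbound t ht)).1]
  exact abs_le.2 ⟨by linarith, by linarith⟩

/-- Estimates for the alternate decomposition w₁ = w₁₁ + w₁₂ of the first singular
component. -/
theorem alternate_decomposition_estimates
    (C₀ α : ℝ) (hC₀ : 0 ≤ C₀) (hα : 0 < α) :
    ∃ C : ℝ, 0 < C ∧
      ∀ ε₁ ε₂ xc₂ : ℝ, 0 < ε₁ → ε₁ < ε₂ → 4 * ε₂ ≤ α →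
      xc₂ ∈ Ioo (0:ℝ) (1/2) →
      Real.exp (-(α * xc₂) / ε₁) / ε₁ ^ 2 = Real.exp (-(α * xc₂) / ε₂) / ε₂ ^ 2 →
      ∀ w₁ w₁₁ w₁₂ : ℝ → ℝ,
        ContDiff ℝ 2 w₁ →
        (∀ k : ℕ, k = 1 ∨ k = 2 → ∀ x ∈ Icc (0:ℝ) 1,
          |iteratedDeriv k w₁ x| ≤
            C₀ * (Real.exp (-(α * x) / ε₁) / ε₁ ^ k + Real.exp (-(α * x) / ε₂) / ε₂ ^ k)) →
        (∀ x : ℝ, w₁₁ x = if x < xc₂ then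
            ∑ k ∈ Finset.range 3, (x - xc₂) ^ k / (Nat.factorial k : ℝ) * iteratedDeriv k w₁ xc₂
          else w₁ x) →
        (∀ x : ℝ, w₁₂ x = w₁ x - w₁₁ x) →
        ∀ x ∈ Icc (0:ℝ) 1,
          |iteratedDeriv 2 w₁₁ x| ≤ C * (Real.exp (-(α * x) / ε₂) / ε₂ ^ 2) ∧
          |deriv w₁₂ x| ≤ C * (Real.exp (-(α * x) / ε₁) / ε₁) := by
  refine ⟨2 * C₀ + 4 * C₀ / α + 1, by positivity, ?_⟩
  intro ε₁ ε₂ c hε₁ hε _ hc hcross w w₁₁ w₁₂ hw hbound hw₁₁ hw₁₂ x hx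
  have hε₂ : 0 < ε₂ := hε₁.trans hε
  have hC : 0 ≤ 4 * C₀ / α := by positivity
  have hdiff : ∀ t, HasDerivAt w (deriv w t) t := fun t =>
    (hw.differentiable (by norm_num) t).hasDerivAt
  have hdiff₂ : ∀ t, HasDerivAt (deriv w) (iteratedDeriv 2 w t) t := fun t => by
    rw [iteratedDeriv_succ, iteratedDeriv_one]
    exact ((ContDiff.deriv' (n := 1) hw).differentiable (by norm_num) t).hasDerivAt
  set a := deriv w c
  set b := iteratedDeriv 2 w c
  have hlin : ∀ t, HasDerivAt (fun y => a + (y - c) * b) b t := fun t => by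
    simpa using (((hasDerivAt_id t).sub_const c).mul_const b).const_add a
  have hquad : ∀ t, HasDerivAt (fun y => w c + (y - c) * a + (y - c) ^ 2 / 2 * b)
      (a + (t - c) * b) t := fun t => by
    have h := (hasDerivAt_id t).sub_const c
    refine (((h.mul_const a).const_add (w c)).add
      (((h.pow 2).div_const 2).mul_const b)).congr_deriv ?_
    simp only [id_eq]
    ring
  have hw₁₁_eq : w₁₁ = fun y => if y < c then w c + (y - c) * a + (y - c) ^ 2 / 2 * b
      else w y := by
    funext y
    simp [hw₁₁, Finset.sum_range_succ, a, b]
  have hderiv : ∀ t, HasDerivAt w₁₁ (if t < c then a + (t - c) * b else deriv w t) t := by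
    rw [hw₁₁_eq]
    exact hasDerivAt_ite_lt hquad hdiff (by simp) (by simp [a])
  have hderiv₂ : iteratedDeriv 2 w₁₁ x = if x < c then b else iteratedDeriv 2 w x := by
    rw [iteratedDeriv_succ, iteratedDeriv_one, funext fun t => (hderiv t).deriv]
    exact (hasDerivAt_ite_lt hlin hdiff₂ (by simp [a]) rfl x).deriv
  have hw₁₂_deriv : deriv w₁₂ x = deriv w x - if x < c then a + (x - c) * b else deriv w x := by
    rw [funext hw₁₂]
    exact ((hdiff x).sub (hderiv x)).deriv
  have hb_le : |b| ≤ 2 * C₀ * (Real.exp (-(α * c) / ε₂) / ε₂ ^ 2) := by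
    have h := hbound 2 (Or.inr rfl) c ⟨hc.1.le, by linarith [hc.2]⟩
    rw [hcross] at h
    linarith
  constructor
  · suffices h : |iteratedDeriv 2 w₁₁ x| ≤ 2 * C₀ * (Real.exp (-(α * x) / ε₂) / ε₂ ^ 2) by
      exact h.trans (mul_le_mul_of_nonneg_right (by linarith) (by positivity))
    rw [hderiv₂]
    split_ifs with hxc
    · exact hb_le.trans
        (mul_le_mul_of_nonneg_left (exp_layer_antitone hα hε₂ 2 hxc.le) (by positivity))
    · have h := mul_le_mul_of_nonneg_left
        (exp_layer_le_of_crossing_le hα hε₁ hε hcross (not_lt.1 hxc)) hC₀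
      linarith [hbound 2 (Or.inr rfl) x hx]
  · suffices h : |deriv w₁₂ x| ≤ 4 * C₀ / α * (Real.exp (-(α * x) / ε₁) / ε₁) by
      exact h.trans (mul_le_mul_of_nonneg_right (by linarith) (by positivity))
    rw [hw₁₂_deriv]
    split_ifs with hxc
    · refine abs_le_of_abs_deriv_le_neg_deriv (h := fun t => deriv w t - (a + (t - c) * b))
        (fun t => (hdiff₂ t).sub (hlin t))
        (fun t => ((hasDerivAt_exp_layer α ε₁ t).div_const ε₁).const_mul (4 * C₀ / α))
        hxc.le (fun t ht => ?_) (by simp [a]) (by positivity)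
      have h₁ := hbound 2 (Or.inr rfl) t ⟨hx.1.trans ht.1, by linarith [hc.2, ht.2]⟩
      have h₂ := mul_le_mul_of_nonneg_left
        (exp_layer_le_of_le_crossing hα hε₁ hε hcross ht.2) hC₀
      have h₃ := mul_le_mul_of_nonneg_left (exp_layer_antitone hα hε₁ 2 ht.2) hC₀
      rw [← hcross] at hb_le
      have h_eq : -(4 * C₀ / α * (-(α / ε₁) * Real.exp (-(α * t) / ε₁) / ε₁)) =
          4 * C₀ * (Real.exp (-(α * t) / ε₁) / ε₁ ^ 2) := by
        field_simp
      rw [h_eq]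
      dsimp only at h₃
      linarith [abs_sub (iteratedDeriv 2 w t) b]
    · rw [sub_self, abs_zero]
      positivity
end

section
/- Discrete maximum principle: Let 0=x₀<x₁<⋯<x_N=1 be any mesh and Ψ=(Ψ₁,Ψ₂)ᵀ a vector mesh function with Ψ(x₀) ≥ 0 and Ψ(x_N) ≥ 0 (componentwise). If (L^NΨ)(x_j) ≤ 0 (componentwise) for 1 ≤ j ≤ N−1, then Ψ(x_j) ≥ 0 (componentwise) for 0 ≤ j ≤ N. -/
open Set

/-- Forward difference quotient on a mesh. -/
noncomputable def Dp (x U : ℕ → ℝ) (j : ℕ) : ℝ := (U (j+1) - U j) / (x (j+1) - x j)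

/-- Backward difference quotient on a mesh. -/
noncomputable def Dm (x U : ℕ → ℝ) (j : ℕ) : ℝ := (U j - U (j-1)) / (x j - x (j-1))

/-- Discrete second-order central difference on a mesh. -/
noncomputable def delta2 (x U : ℕ → ℝ) (j : ℕ) : ℝ :=
  (Dp x U j - Dm x U j) / ((x (j+1) - x (j-1)) / 2)

/-- First component of the discrete operator L^N. -/
noncomputable def LN1 (ε : ℝ) (a b₁₁ b₁₂ : ℝ → ℝ) (x Ψ₁ Ψ₂ : ℕ → ℝ) (j : ℕ) : ℝ :=
  ε * delta2 x Ψ₁ j + a (x j) * Dp x Ψ₁ j - b₁₁ (x j) * Ψ₁ j + b₁₂ (x j) * Ψ₂ j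

/-- Second component of the discrete operator L^N. -/
noncomputable def LN2 (ε : ℝ) (a b₂₂ b₂₁ : ℝ → ℝ) (x Ψ₁ Ψ₂ : ℕ → ℝ) (j : ℕ) : ℝ :=
  ε * delta2 x Ψ₂ j + a (x j) * Dp x Ψ₂ j - b₂₂ (x j) * Ψ₂ j + b₂₁ (x j) * Ψ₁ j

/-- The second difference is nonnegative at a local minimum. -/
theorem delta2_nonneg_of_le {x U : ℕ → ℝ} {j : ℕ} (hl : x (j-1) < x j) (hr : x j < x (j+1))
    (hUl : U j ≤ U (j-1)) (hUr : U j ≤ U (j+1)) : 0 ≤ delta2 x U j := by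
  have hp : 0 ≤ Dp x U j := div_nonneg (by linarith) (by linarith)
  have hm : Dm x U j ≤ 0 := div_nonpos_of_nonpos_of_nonneg (by linarith) (by linarith)
  exact div_nonneg (by linarith) (by linarith)

/-- The discrete operator is positive at a negative local minimum of the first component that
also bounds the second component from below. -/
theorem LN1_pos_of_neg_min {ε : ℝ} {a b c : ℝ → ℝ} {x U V : ℕ → ℝ} {j : ℕ}
    (hε : 0 ≤ ε) (ha : 0 ≤ a (x j)) (hbc : 0 < b (x j) - c (x j)) (hc : 0 ≤ c (x j))
    (hl : x (j-1) < x j) (hr : x j < x (j+1))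
    (hUl : U j ≤ U (j-1)) (hUr : U j ≤ U (j+1)) (hUV : U j ≤ V j) (hneg : U j < 0) :
    0 < LN1 ε a b c x U V j := by
  have h1 : 0 ≤ ε * delta2 x U j := mul_nonneg hε (delta2_nonneg_of_le hl hr hUl hUr)
  have h2 : 0 ≤ a (x j) * Dp x U j :=
    mul_nonneg ha (div_nonneg (by linarith) (by linarith))
  have h3 : c (x j) * U j ≤ c (x j) * V j := mul_le_mul_of_nonneg_left hUV hc
  have h4 : (b (x j) - c (x j)) * U j < 0 := mul_neg_of_pos_of_neg hbc hneg
  unfold LN1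
  linarith

/-- If `L^N` is nonpositive in the interior and the boundary values are nonnegative, then a component
is nonnegative where it attains its minimum, provided it is the smaller component there. -/
theorem nonneg_at_min {ε : ℝ} {a b c : ℝ → ℝ} {x U V : ℕ → ℝ} {N j : ℕ}
    (hε : 0 ≤ ε) (ha : ∀ t ∈ Icc (0:ℝ) 1, 0 ≤ a t)
    (hbc : ∀ t ∈ Icc (0:ℝ) 1, 0 < b t - c t) (hc : ∀ t ∈ Icc (0:ℝ) 1, 0 ≤ c t)
    (hx : ∀ i ≤ N, x i ∈ Icc (0:ℝ) 1) (hmono : ∀ i < N, x i < x (i+1))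
    (hU0 : 0 ≤ U 0) (hUN : 0 ≤ U N)
    (hL : ∀ i, 1 ≤ i → i < N → LN1 ε a b c x U V i ≤ 0)
    (hj : j ≤ N) (hmin : ∀ i ≤ N, U j ≤ U i) (hUV : U j ≤ V j) : 0 ≤ U j := by
  by_contra! hneg
  have hj0 : j ≠ 0 := by rintro rfl; linarith
  have hjN : j ≠ N := by rintro rfl; linarith
  have hlt : j < N := lt_of_le_of_ne hj hjN
  have hl : x (j-1) < x j := by
    simpa [Nat.sub_add_cancel (Nat.one_le_iff_ne_zero.mpr hj0)] using hmono (j-1) (by omega)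
  have hxj := hx j hj
  exact absurd (hL j (by omega) hlt) (not_le.mpr
    (LN1_pos_of_neg_min hε (ha _ hxj) (hbc _ hxj) (hc _ hxj) hl (hmono j hlt)
      (hmin _ (by omega)) (hmin _ (by omega)) hUV hneg))

/-- The nodes of a mesh with end points `0` and `1` lie in the unit interval. -/
theorem mesh_mem_Icc {x : ℕ → ℝ} {N : ℕ} (hx0 : x 0 = 0) (hxN : x N = 1)
    (hmono : ∀ j < N, x j < x (j+1)) : ∀ i ≤ N, x i ∈ Icc (0:ℝ) 1 := by
  have hle : ∀ i k, i ≤ k → k ≤ N → x i ≤ x k := by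
    intro i k hik
    induction k, hik using Nat.le_induction with
    | base => exact fun _ => le_rfl
    | succ k _ ih => exact fun hk => (ih (by omega)).trans (hmono k (by omega)).le
  exact fun i hi => ⟨hx0 ▸ hle 0 i i.zero_le hi, hxN ▸ hle i N hi le_rfl⟩

/-- Discrete maximum principle for the upwind scheme on an arbitrary mesh. -/
theorem discrete_maximum_principle
    (ε₁ ε₂ α β : ℝ) (a₁ a₂ b₁₁ b₁₂ b₂₁ b₂₂ : ℝ → ℝ)
    (hε₁ : 0 < ε₁) (hε₁₂ : ε₁ < ε₂) (hα : 0 < α) (hβ : 0 < β)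
    (ha₁ : ∀ x ∈ Icc (0:ℝ) 1, α ≤ a₁ x) (ha₂ : ∀ x ∈ Icc (0:ℝ) 1, α ≤ a₂ x)
    (hb₁ : ∀ x ∈ Icc (0:ℝ) 1, β ≤ b₁₁ x - b₁₂ x)
    (hb₂ : ∀ x ∈ Icc (0:ℝ) 1, β ≤ b₂₂ x - b₂₁ x)
    (hb₁₂ : ∀ x ∈ Icc (0:ℝ) 1, 0 < b₁₂ x) (hb₂₁ : ∀ x ∈ Icc (0:ℝ) 1, 0 < b₂₁ x)
    (N : ℕ) (hN : 1 ≤ N) (x : ℕ → ℝ)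
    (hx0 : x 0 = 0) (hxN : x N = 1) (hmono : ∀ j < N, x j < x (j+1))
    (Ψ₁ Ψ₂ : ℕ → ℝ)
    (h0 : 0 ≤ Ψ₁ 0 ∧ 0 ≤ Ψ₂ 0) (hNbc : 0 ≤ Ψ₁ N ∧ 0 ≤ Ψ₂ N)
    (hL : ∀ j, 1 ≤ j → j < N →
      LN1 ε₁ a₁ b₁₁ b₁₂ x Ψ₁ Ψ₂ j ≤ 0 ∧ LN2 ε₂ a₂ b₂₂ b₂₁ x Ψ₁ Ψ₂ j ≤ 0) :
    ∀ j ≤ N, 0 ≤ Ψ₁ j ∧ 0 ≤ Ψ₂ j := by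
  have hx := mesh_mem_Icc hx0 hxN hmono
  have hne : (Finset.range (N+1)).Nonempty := ⟨0, by simp⟩
  obtain ⟨p, hp, hpmin⟩ := Finset.exists_min_image _ Ψ₁ hne
  obtain ⟨q, hq, hqmin⟩ := Finset.exists_min_image _ Ψ₂ hne
  have hp : p ≤ N := by simpa [Nat.lt_succ_iff] using hp
  have hq : q ≤ N := by simpa [Nat.lt_succ_iff] using hq
  have hpmin : ∀ i ≤ N, Ψ₁ p ≤ Ψ₁ i := fun i hi => hpmin i (by simpa [Nat.lt_succ_iff] using hi)
  have hqmin : ∀ i ≤ N, Ψ₂ q ≤ Ψ₂ i := fun i hi => hqmin i (by simpa [Nat.lt_succ_iff] using hi)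
  have hP : Ψ₁ p ≤ Ψ₂ q → 0 ≤ Ψ₁ p := fun h =>
    nonneg_at_min hε₁.le (fun t ht => hα.le.trans (ha₁ t ht)) (fun t ht => hβ.trans_le (hb₁ t ht))
      (fun t ht => (hb₁₂ t ht).le) hx hmono h0.1 hNbc.1 (fun i h1 h2 => (hL i h1 h2).1)
      hp hpmin (h.trans (hqmin p hp))
  have hQ : Ψ₂ q ≤ Ψ₁ p → 0 ≤ Ψ₂ q := fun h =>
    nonneg_at_min (hε₁.trans hε₁₂).le (fun t ht => hα.le.trans (ha₂ t ht))
      (fun t ht => hβ.trans_le (hb₂ t ht)) (fun t ht => (hb₂₁ t ht).le) hx hmono h0.2 hNbc.2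
      (fun i h1 h2 => (hL i h1 h2).2) hq hqmin (h.trans (hpmin q hq))
  have hPQ : 0 ≤ Ψ₁ p ∧ 0 ≤ Ψ₂ q := by
    rcases le_total (Ψ₁ p) (Ψ₂ q) with h | h
    · exact ⟨hP h, (hP h).trans h⟩
    · exact ⟨(hQ h).trans h, hQ h⟩
  exact fun j hj => ⟨hPQ.1.trans (hpmin j hj), hPQ.2.trans (hqmin j hj)⟩
end

section
/- Discrete stability result: Let 0=x₀<x₁<⋯<x_N=1 be any mesh and Ψ=(Ψ₁,Ψ₂)ᵀ any vector mesh function. Then for i=1,2 and 0 ≤ j ≤ N: |Ψᵢ(x_j)| ≤ max{ ‖Ψ(x₀)‖, ‖Ψ(x_N)‖, (1/β) max_{1≤k≤N−1} max{|(L^NΨ)₁(x_k)|, |(L^NΨ)₂(x_k)|} }, where ‖Ψ(x₀)‖=max{|Ψ₁(x₀)|,|Ψ₂(x₀)|} and similarly for ‖Ψ(x_N)‖. -/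
open Set

theorem delta2_nonpos_of_le {x U : ℕ → ℝ} {k : ℕ} (hl : x (k - 1) < x k) (hr : x k < x (k + 1))
    (hUl : U (k - 1) ≤ U k) (hUr : U (k + 1) ≤ U k) : delta2 x U k ≤ 0 := by
  have hp : Dp x U k ≤ 0 := div_nonpos_of_nonpos_of_nonneg (by linarith) (by linarith)
  have hm : 0 ≤ Dm x U k := div_nonneg (by linarith) (by linarith)
  exact div_nonpos_of_nonpos_of_nonneg (by linarith) (by linarith)

theorem LN1_neg (ε : ℝ) (a b c : ℝ → ℝ) (x U V : ℕ → ℝ) (k : ℕ) :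
    LN1 ε a b c x (-U) (-V) k = -LN1 ε a b c x U V k := by
  simp only [LN1, delta2, Dp, Dm, Pi.neg_apply]
  ring

/-- Discrete maximum principle for one component: at an interior maximum `U k ≥ 0` dominating
the coupled component, the operator is at most `-β * U k`. -/
theorem LN1_le_of_isMax {ε β : ℝ} {a b c : ℝ → ℝ} {x U V : ℕ → ℝ} {k : ℕ}
    (hε : 0 ≤ ε) (ha : 0 ≤ a (x k)) (hbc : β ≤ b (x k) - c (x k)) (hc : 0 ≤ c (x k))
    (hl : x (k - 1) < x k) (hr : x k < x (k + 1))
    (hUl : U (k - 1) ≤ U k) (hUr : U (k + 1) ≤ U k) (hV : V k ≤ U k) (hU : 0 ≤ U k) :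
    LN1 ε a b c x U V k ≤ -(β * U k) := by
  have hp : Dp x U k ≤ 0 := div_nonpos_of_nonpos_of_nonneg (by linarith) (by linarith)
  have h₁ := mul_nonpos_of_nonneg_of_nonpos hε (delta2_nonpos_of_le hl hr hUl hUr)
  have h₂ := mul_nonpos_of_nonneg_of_nonpos ha hp
  have h₃ := mul_le_mul_of_nonneg_left hV hc
  have h₄ := mul_le_mul_of_nonneg_right hbc hU
  unfold LN1
  linarith

theorem mul_abs_le_abs_LN1 {ε β : ℝ} {a b c : ℝ → ℝ} {x U V : ℕ → ℝ} {k : ℕ}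
    (hε : 0 ≤ ε) (ha : 0 ≤ a (x k)) (hbc : β ≤ b (x k) - c (x k)) (hc : 0 ≤ c (x k))
    (hl : x (k - 1) < x k) (hr : x k < x (k + 1))
    (hUl : |U (k - 1)| ≤ |U k|) (hUr : |U (k + 1)| ≤ |U k|) (hV : |V k| ≤ |U k|) :
    β * |U k| ≤ |LN1 ε a b c x U V k| := by
  rcases le_total 0 (U k) with h | h
  · rw [abs_of_nonneg h] at *
    have := LN1_le_of_isMax hε ha hbc hc hl hr (abs_le.1 hUl).2 (abs_le.1 hUr).2 (abs_le.1 hV).2 h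
    linarith [neg_abs_le (LN1 ε a b c x U V k)]
  · rw [abs_of_nonpos h] at *
    have := LN1_le_of_isMax (U := -U) (V := -V) hε ha hbc hc hl hr
      (by simpa using (abs_le.1 hUl).1) (by simpa using (abs_le.1 hUr).1)
      (by simpa using (abs_le.1 hV).1) (by simpa using h)
    rw [LN1_neg, Pi.neg_apply] at this
    linarith [le_abs_self (LN1 ε a b c x U V k)]

/-- Discrete stability result for the upwind scheme on an arbitrary mesh. -/
theorem discrete_stability
    (ε₁ ε₂ α β : ℝ) (a₁ a₂ b₁₁ b₁₂ b₂₁ b₂₂ : ℝ → ℝ)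
    (hε₁ : 0 < ε₁) (hε₁₂ : ε₁ < ε₂) (hα : 0 < α) (hβ : 0 < β)
    (ha₁ : ∀ x ∈ Icc (0:ℝ) 1, α ≤ a₁ x) (ha₂ : ∀ x ∈ Icc (0:ℝ) 1, α ≤ a₂ x)
    (hb₁ : ∀ x ∈ Icc (0:ℝ) 1, β ≤ b₁₁ x - b₁₂ x)
    (hb₂ : ∀ x ∈ Icc (0:ℝ) 1, β ≤ b₂₂ x - b₂₁ x)
    (hb₁₂ : ∀ x ∈ Icc (0:ℝ) 1, 0 < b₁₂ x) (hb₂₁ : ∀ x ∈ Icc (0:ℝ) 1, 0 < b₂₁ x)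
    (N : ℕ) (hN : 2 ≤ N) (x : ℕ → ℝ)
    (hx0 : x 0 = 0) (hxN : x N = 1) (hmono : ∀ j < N, x j < x (j+1))
    (Ψ₁ Ψ₂ : ℕ → ℝ) :
    ∀ M : ℝ,
      M = max (max (max |Ψ₁ 0| |Ψ₂ 0|) (max |Ψ₁ N| |Ψ₂ N|))
        (β⁻¹ * (Finset.Ico 1 N).sup' (Finset.nonempty_Ico.mpr (by omega))
          (fun k => max |LN1 ε₁ a₁ b₁₁ b₁₂ x Ψ₁ Ψ₂ k| |LN2 ε₂ a₂ b₂₂ b₂₁ x Ψ₁ Ψ₂ k|)) →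
      ∀ j ≤ N, |Ψ₁ j| ≤ M ∧ |Ψ₂ j| ≤ M := by
  rintro M hM
  obtain ⟨k, hk, hmax⟩ := Finset.exists_max_image (Finset.range (N + 1))
    (fun k => max |Ψ₁ k| |Ψ₂ k|) ⟨0, by simp⟩
  have hkN : k ≤ N := by simpa [Nat.lt_succ_iff] using hk
  have hmax' : ∀ j ≤ N, max |Ψ₁ j| |Ψ₂ j| ≤ max |Ψ₁ k| |Ψ₂ k| := fun j hj =>
    hmax j (by simpa [Nat.lt_succ_iff] using hj)
  suffices h : max |Ψ₁ k| |Ψ₂ k| ≤ M from fun j hj => max_le_iff.1 ((hmax' j hj).trans h)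
  rcases Nat.eq_zero_or_pos k with rfl | hk0
  · rw [hM]
    exact (le_max_left _ _).trans (le_max_left _ _)
  rcases hkN.eq_or_lt with rfl | hkN'
  · rw [hM]
    exact (le_max_right _ _).trans (le_max_left _ _)
  have hx : MonotoneOn x (Icc 0 N) :=
    monotoneOn_of_le_succ ordConnected_Icc fun j _ _ hj => (hmono j hj.2).le
  have hxk : x k ∈ Icc (0 : ℝ) 1 :=
    ⟨hx0 ▸ hx ⟨le_rfl, by omega⟩ ⟨by omega, hkN⟩ (by omega),
      hxN ▸ hx ⟨by omega, hkN⟩ ⟨by omega, le_rfl⟩ hkN⟩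
  have hl : x (k - 1) < x k := by
    simpa [Nat.sub_add_cancel hk0] using hmono (k - 1) (by omega)
  have hr := hmono k hkN'
  have hleft := max_le_iff.1 (hmax' (k - 1) (by omega))
  have hright := max_le_iff.1 (hmax' (k + 1) hkN')
  have key : β * max |Ψ₁ k| |Ψ₂ k| ≤
      max |LN1 ε₁ a₁ b₁₁ b₁₂ x Ψ₁ Ψ₂ k| |LN2 ε₂ a₂ b₂₂ b₂₁ x Ψ₁ Ψ₂ k| := by
    rcases le_total |Ψ₂ k| |Ψ₁ k| with h | h
    · rw [max_eq_left h] at hleft hright ⊢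
      exact (mul_abs_le_abs_LN1 hε₁.le (hα.le.trans (ha₁ _ hxk)) (hb₁ _ hxk) (hb₁₂ _ hxk).le
        hl hr hleft.1 hright.1 h).trans (le_max_left _ _)
    · rw [max_eq_right h] at hleft hright ⊢
      exact (mul_abs_le_abs_LN1 (hε₁.trans hε₁₂).le (hα.le.trans (ha₂ _ hxk)) (hb₂ _ hxk)
        (hb₂₁ _ hxk).le hl hr hleft.2 hright.2 h).trans (le_max_right _ _)
  rw [hM]
  refine le_trans ?_ (le_max_right _ _)
  rw [le_inv_mul_iff₀ hβ]
  exact key.trans (Finset.le_sup' (fun k => max |LN1 ε₁ a₁ b₁₁ b₁₂ x Ψ₁ Ψ₂ k|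
    |LN2 ε₂ a₂ b₂₂ b₂₁ x Ψ₁ Ψ₂ k|) (Finset.mem_Ico.2 ⟨hk0, hkN'⟩))
end

section
/- Discrete barrier property of the layer mesh function: Let 0=x₀<x₁<⋯<x_N=1 be any mesh and define B₂^N(x₀)=1 and B₂^N(x_j)=∏_{i=1}^{j}(1+αh_i/(2ε₂))⁻¹ for 1 ≤ j ≤ N. Then for 1 ≤ j ≤ N−1, the vector mesh function (B₂^N, B₂^N)ᵀ satisfies (L^N(B₂^N,B₂^N)ᵀ)(x_j) ≤ 0 componentwise. -/
open Set

/-- The discrete layer mesh function B₂^N. -/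
noncomputable def B2N (α ε₂ : ℝ) (x : ℕ → ℝ) (j : ℕ) : ℝ :=
  ∏ i ∈ Finset.Icc 1 j, (1 + α * (x i - x (i-1)) / (2 * ε₂))⁻¹

theorem B2N_succ (α ε₂ : ℝ) (x : ℕ → ℝ) (j : ℕ) :
    B2N α ε₂ x (j + 1) = B2N α ε₂ x j * (1 + α * (x (j + 1) - x j) / (2 * ε₂))⁻¹ := by
  simp [B2N, Finset.prod_Icc_succ_top, mul_comm]

theorem B2N_pos {α ε₂ : ℝ} {x : ℕ → ℝ} {N : ℕ} (hα : 0 < α) (hε₂ : 0 < ε₂)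
    (hmono : ∀ j < N, x j < x (j + 1)) : ∀ j ≤ N, 0 < B2N α ε₂ x j
  | 0, _ => by simp [B2N]
  | j + 1, hj => by
    rw [B2N_succ]
    have hB := B2N_pos hα hε₂ hmono j (by lia)
    have hh : 0 < x (j + 1) - x j := sub_pos.2 (hmono j hj)
    positivity

theorem Dp_B2N {α ε₂ : ℝ} {x : ℕ → ℝ} {j : ℕ} (hα : 0 < α) (hε₂ : 0 < ε₂)
    (hx : x j < x (j + 1)) :
    Dp x (B2N α ε₂ x) j = -(α / (2 * ε₂)) * B2N α ε₂ x (j + 1) := by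
  have hh : 0 < x (j + 1) - x j := sub_pos.2 hx
  have hd : 0 < 1 + α * (x (j + 1) - x j) / (2 * ε₂) := by positivity
  have hB : B2N α ε₂ x j = B2N α ε₂ x (j + 1) * (1 + α * (x (j + 1) - x j) / (2 * ε₂)) := by
    rw [B2N_succ, inv_mul_cancel_right₀ hd.ne']
  rw [Dp, hB, div_eq_iff hh.ne']
  ring

theorem Dm_succ (x U : ℕ → ℝ) (j : ℕ) : Dm x U (j + 1) = Dp x U j := rfl

/-- The convection-diffusion part of the operator is nonpositive on the layer function. -/
theorem delta2_add_Dp_B2N_nonpos {ε ε₂ α a : ℝ} {x : ℕ → ℝ} {N j : ℕ} (hα : 0 < α)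
    (hε : 0 < ε) (hεε₂ : ε ≤ ε₂) (ha : α ≤ a) (hmono : ∀ j < N, x j < x (j + 1))
    (hj : j + 1 < N) :
    ε * delta2 x (B2N α ε₂ x) (j + 1) + a * Dp x (B2N α ε₂ x) (j + 1) ≤ 0 := by
  have hε₂ : 0 < ε₂ := hε.trans_le hεε₂
  have h₁ := hmono j (by lia)
  have h₂ := hmono (j + 1) hj
  have hB := B2N_pos hα hε₂ hmono (j + 2) hj
  have hD := Dp_B2N hα hε₂ h₂
  set k := α / (2 * ε₂) with hk
  have hk0 : 0 < k := by positivity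
  have hkα : 2 * ε₂ * k = α := by rw [hk]; field_simp
  have hdiff : B2N α ε₂ x (j + 1) - B2N α ε₂ x (j + 2) =
      k * B2N α ε₂ x (j + 2) * (x (j + 2) - x (j + 1)) := by
    rw [Dp, div_eq_iff (sub_pos.2 h₂).ne'] at hD
    linarith
  have hδ : delta2 x (B2N α ε₂ x) (j + 1) ≤ 2 * k ^ 2 * B2N α ε₂ x (j + 2) := by
    rw [delta2, Dm_succ, hD, Dp_B2N hα hε₂ h₁, ← hk, Nat.add_sub_cancel,
      div_le_iff₀ (by linarith)]
    have hgap : 0 ≤ k ^ 2 * B2N α ε₂ x (j + 2) * (x (j + 1) - x j) :=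
      mul_nonneg (by positivity) (sub_pos.2 h₁).le
    linear_combination hgap + k * hdiff
  rw [hD]
  calc ε * delta2 x (B2N α ε₂ x) (j + 1) + a * (-k * B2N α ε₂ x (j + 2))
      ≤ ε₂ * (2 * k ^ 2 * B2N α ε₂ x (j + 2)) + α * (-k * B2N α ε₂ x (j + 2)) := by
        have hkB : 0 < k * B2N α ε₂ x (j + 2) := by positivity
        have hleft : ε * delta2 x (B2N α ε₂ x) (j + 1) ≤
            ε₂ * (2 * k ^ 2 * B2N α ε₂ x (j + 2)) :=
          (mul_le_mul_of_nonneg_left hδ hε.le).trans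
            (mul_le_mul_of_nonneg_right hεε₂ (by positivity))
        linarith [mul_le_mul_of_nonneg_right ha hkB.le]
    _ = 0 := by rw [← hkα]; ring

/-- Discrete barrier property: the vector mesh function (B₂^N, B₂^N)ᵀ satisfies
L^N(B₂^N, B₂^N)ᵀ ≤ 0 at every interior mesh point. -/
theorem discrete_barrier_property
    (ε₁ ε₂ α β : ℝ) (a₁ a₂ b₁₁ b₁₂ b₂₁ b₂₂ : ℝ → ℝ)
    (hε₁ : 0 < ε₁) (hε₁₂ : ε₁ < ε₂) (hα : 0 < α) (hβ : 0 < β)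
    (ha₁ : ∀ x ∈ Icc (0:ℝ) 1, α ≤ a₁ x) (ha₂ : ∀ x ∈ Icc (0:ℝ) 1, α ≤ a₂ x)
    (hb₁ : ∀ x ∈ Icc (0:ℝ) 1, β ≤ b₁₁ x - b₁₂ x)
    (hb₂ : ∀ x ∈ Icc (0:ℝ) 1, β ≤ b₂₂ x - b₂₁ x)
    (hb₁₂ : ∀ x ∈ Icc (0:ℝ) 1, 0 < b₁₂ x) (hb₂₁ : ∀ x ∈ Icc (0:ℝ) 1, 0 < b₂₁ x)
    (N : ℕ) (hN : 1 ≤ N) (x : ℕ → ℝ)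
    (hx0 : x 0 = 0) (hxN : x N = 1) (hmono : ∀ j < N, x j < x (j+1)) :
    ∀ j, 1 ≤ j → j < N →
      LN1 ε₁ a₁ b₁₁ b₁₂ x (B2N α ε₂ x) (B2N α ε₂ x) j ≤ 0 ∧
      LN2 ε₂ a₂ b₂₂ b₂₁ x (B2N α ε₂ x) (B2N α ε₂ x) j ≤ 0 := by
  rintro (_ | j) hj hjN
  · lia
  have hx : StrictMonoOn x (Icc 0 N) := strictMonoOn_of_lt_succ ordConnected_Icc
    fun i _ _ hi => hmono i hi.2
  have hmem : x (j + 1) ∈ Icc (0 : ℝ) 1 := by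
    rw [← hx0, ← hxN]
    exact ⟨hx.monotoneOn (by simp) (by simp; lia) (by lia),
      hx.monotoneOn (by simp; lia) (by simp) hjN.le⟩
  have hB := B2N_pos hα (hε₁.trans hε₁₂) hmono (j + 1) hjN.le
  have h₁ := delta2_add_Dp_B2N_nonpos hα hε₁ hε₁₂.le (ha₁ _ hmem) hmono hjN
  have h₂ := delta2_add_Dp_B2N_nonpos hα (hε₁.trans hε₁₂) le_rfl (ha₂ _ hmem) hmono hjN
  have hr₁ := mul_nonneg (hβ.le.trans (hb₁ _ hmem)) hB.le
  have hr₂ := mul_nonneg (hβ.le.trans (hb₂ _ hmem)) hB.le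
  rw [LN1, LN2]
  constructor <;> linarith
end
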